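/- arXiv:1507.01215 — 4 statements merged into one kernel-verified Lean document; each statement's English description precedes it below -/
import Mathlib

section
/- If a class C of r.e. sets is conservatively partially (ConsvPart) learnable, then there is a single learner which simultaneously finitely approximately (FinApprox) learns C and conservatively partially (ConsvPart) learns C. -/
open Filter

/-- The `e`-th partial recursive function in a fixed acceptable numbering. -/
def phi (e : ℕ) : ℕ →. ℕ := Nat.Partrec.Code.eval (Denumerable.ofNat Nat.Partrec.Code e)

/-- The `e`-th recursively enumerable set, `W_e = dom(φ_e)`. -/
def Wset (e : ℕ) : Set ℕ := (phi e).Dom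

/-- `T` is a text for `L`: the natural numbers occurring in `T` are exactly
the members of `L` (`none` plays the role of the pause symbol `#`). -/
def IsText (T : ℕ → Option ℕ) (L : Set ℕ) : Prop :=
  {x : ℕ | ∃ n, T n = some x} = L

/-- The finite sequence `T[n] = T(0), ..., T(n-1)`. -/
def pref (T : ℕ → Option ℕ) (n : ℕ) : List (Option ℕ) :=
  (List.range n).map T

/-- `M` partially (Part) learns `C`: on every text for every `L ∈ C` there is
exactly one index output infinitely often, and that index is an index of `L`. -/
def PartLearns (M : List (Option ℕ) → ℕ) (C : Set (Set ℕ)) : Prop :=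
  ∀ L ∈ C, ∀ T : ℕ → Option ℕ, IsText T L →
    ∃ e, {n | M (pref T n) = e}.Infinite ∧ Wset e = L ∧
      ∀ d, {n | M (pref T n) = d}.Infinite → d = e

/-- `M` is consistent (Cons): every number occurring in `σ` belongs to `W_{M(σ)}`. -/
def ConsLearner (M : List (Option ℕ) → ℕ) : Prop :=
  ∀ σ : List (Option ℕ), ∀ x : ℕ, some x ∈ σ → x ∈ Wset (M σ)

/-- `M` finitely approximately (FinApprox) learns `C`. -/
def FinApproxLearns (M : List (Option ℕ) → ℕ) (C : Set (Set ℕ)) : Prop :=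
  ∀ L ∈ C, ∀ T : ℕ → Option ℕ, IsText T L → ∀ D : Finset ℕ,
    ∀ᶠ n in atTop, Wset (M (pref T n)) ∩ ↑D = L ∩ ↑D

/-- `M` BC*-learns `C`: almost all hypotheses are finite variants of the target. -/
def BCstarLearns (M : List (Option ℕ) → ℕ) (C : Set (Set ℕ)) : Prop :=
  ∀ L ∈ C, ∀ T : ℕ → Option ℕ, IsText T L →
    ∀ᶠ n in atTop, (symmDiff (Wset (M (pref T n))) L).Finite

/-- `M` BC^k-learns `C`: almost all hypotheses differ from the target in at
most `k` elements. -/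
def BCnLearns (k : ℕ) (M : List (Option ℕ) → ℕ) (C : Set (Set ℕ)) : Prop :=
  ∀ L ∈ C, ∀ T : ℕ → Option ℕ, IsText T L →
    ∀ᶠ m in atTop, (symmDiff (Wset (M (pref T m))) L).Finite ∧
      (symmDiff (Wset (M (pref T m))) L).ncard ≤ k

/-- `M` behaviourally correctly (BC) learns `C`. -/
def BCLearns (M : List (Option ℕ) → ℕ) (C : Set (Set ℕ)) : Prop :=
  ∀ L ∈ C, ∀ T : ℕ → Option ℕ, IsText T L →
    ∀ᶠ n in atTop, Wset (M (pref T n)) = L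

/-- `M` explanatorily (Ex) learns `C`. -/
def ExLearns (M : List (Option ℕ) → ℕ) (C : Set (Set ℕ)) : Prop :=
  ∀ L ∈ C, ∀ T : ℕ → Option ℕ, IsText T L →
    ∃ e n₀, Wset e = L ∧ ∀ n ≥ n₀, M (pref T n) = e

/-- `M` weakly approximately (WeakApprox) learns `C`: for every text there is
an infinite set `W` such that on every finite variant `V` of `W` almost all
hypotheses agree with the target. -/
def WeakApproxLearns (M : List (Option ℕ) → ℕ) (C : Set (Set ℕ)) : Prop :=
  ∀ L ∈ C, ∀ T : ℕ → Option ℕ, IsText T L →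
    ∃ W : Set ℕ, W.Infinite ∧ ∀ V : Set ℕ, (symmDiff V W).Finite →
      ∀ᶠ n in atTop, Wset (M (pref T n)) ∩ V = L ∩ V

/-- `M` approximately (Approx) learns `C`: for every `L ∈ C` there is an
infinite set `W`, good for all texts for `L`. -/
def ApproxLearns (M : List (Option ℕ) → ℕ) (C : Set (Set ℕ)) : Prop :=
  ∀ L ∈ C, ∃ W : Set ℕ, W.Infinite ∧ ∀ T : ℕ → Option ℕ, IsText T L →
    ∀ V : Set ℕ, (symmDiff V W).Finite →
      ∀ᶠ n in atTop, Wset (M (pref T n)) ∩ V = L ∩ V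

/-- Conservativeness for partial learners: on each text for every `L ∈ C`, `M`
outputs exactly one index `e` with `L ⊆ W_e`. -/
def ConsvLearner (M : List (Option ℕ) → ℕ) (C : Set (Set ℕ)) : Prop :=
  ∀ L ∈ C, ∀ T : ℕ → Option ℕ, IsText T L →
    ∃! e, (∃ n, M (pref T n) = e) ∧ L ⊆ Wset e

/-- Confidence: on every infinite sequence, `M` outputs exactly one index
infinitely often. -/
def Confident (M : List (Option ℕ) → ℕ) : Prop :=
  ∀ T : ℕ → Option ℕ, ∃! e, {n | M (pref T n) = e}.Infinite

/-- The sets ever conjectured by `M` (used to express prudence). -/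
def Conjectured (M : List (Option ℕ) → ℕ) : Set (Set ℕ) :=
  {S | ∃ σ : List (Option ℕ), S = Wset (M σ)}

open Nat.Partrec (Code)
open Encodable Denumerable

/-- All numbers occurring in `τ` are enumerated into `W_d` within `s` steps. -/
def CoveredBy (d s : ℕ) (τ : List (Option ℕ)) : Prop :=
  ∀ o ∈ τ, (o.elim true fun x => (Code.evaln s (ofNat Code d) x).isSome) = true

instance (d s : ℕ) (τ : List (Option ℕ)) : Decidable (CoveredBy d s τ) :=
  inferInstanceAs (Decidable (∀ o ∈ τ, _))

theorem CoveredBy.mono {d s t : ℕ} {τ : List (Option ℕ)} (h : CoveredBy d s τ) (hst : s ≤ t) :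
    CoveredBy d t τ := by
  rintro (_ | x) ho
  · rfl
  · have := h _ ho
    simp only [Option.elim_some, Option.isSome_iff_exists] at this ⊢
    obtain ⟨y, hy⟩ := this
    exact ⟨y, Code.evaln_mono hst hy⟩

theorem mem_Wset_iff {d x : ℕ} :
    x ∈ Wset d ↔ ∃ s, (Code.evaln s (ofNat Code d) x).isSome = true := by
  simp only [Wset, phi, PFun.mem_dom, Code.evaln_complete, Option.isSome_iff_exists]
  exact exists_comm

theorem CoveredBy.mem_Wset {d s x : ℕ} {τ : List (Option ℕ)} (h : CoveredBy d s τ)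
    (hx : some x ∈ τ) : x ∈ Wset d :=
  mem_Wset_iff.2 ⟨s, h _ hx⟩

theorem exists_coveredBy {d : ℕ} {τ : List (Option ℕ)} (h : ∀ x, some x ∈ τ → x ∈ Wset d) :
    ∃ s, CoveredBy d s τ := by
  induction τ with
  | nil => exact ⟨0, by simp [CoveredBy]⟩
  | cons o τ ih =>
    obtain ⟨s, hs⟩ := ih fun x hx => h x (List.mem_cons_of_mem _ hx)
    cases o with
    | none => exact ⟨s, by simpa [CoveredBy] using hs⟩
    | some y =>
      obtain ⟨t, ht⟩ := mem_Wset_iff.1 (h y List.mem_cons_self)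
      have hy : CoveredBy d t [some y] := by simpa [CoveredBy] using ht
      refine ⟨max s t, List.forall_mem_cons.2 ⟨?_, hs.mono (le_max_left _ _)⟩⟩
      exact hy.mono (le_max_right _ _) _ List.mem_cons_self

theorem primrec_coveredBy :
    Primrec fun p : (ℕ × ℕ) × List (Option ℕ) => decide (CoveredBy p.1.1 p.1.2 p.2) := by
  have h : PrimrecRel fun (o : Option ℕ) (p : ℕ × ℕ) =>
      (o.elim true fun x => (Code.evaln p.2 (ofNat Code p.1) x).isSome) = true := by
    refine Primrec.eq.comp (f := fun q : Option ℕ × ℕ × ℕ => _) ?_ (Primrec.const true)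
    refine (Primrec.option_casesOn Primrec.fst (Primrec.const true)
      (g := fun q x => (Code.evaln q.2.2 (ofNat Code q.2.1) x).isSome) ?_).of_eq ?_
    · refine Primrec.option_isSome.comp (Code.primrec_evaln.comp
        (.pair (.pair (Primrec.snd.comp (Primrec.snd.comp Primrec.fst))
          ((Primrec.ofNat Code).comp (Primrec.fst.comp (Primrec.snd.comp Primrec.fst))))
          Primrec.snd))
    · rintro ⟨_ | x, p⟩ <;> rfl
  exact ((h.forall_mem_list.comp Primrec.snd Primrec.fst).of_eq fun _ => Iff.rfl).decide

/-- `s` is the least number of steps within which `W_d` is seen to cover `τ`. -/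
def settles (d s : ℕ) (τ : List (Option ℕ)) : Bool :=
  decide (CoveredBy d s τ) && (s == 0 || !decide (CoveredBy d (s - 1) τ))

theorem CoveredBy.of_settles {d s : ℕ} {τ : List (Option ℕ)} (h : settles d s τ = true) :
    CoveredBy d s τ := by
  simp only [settles, Bool.and_eq_true, decide_eq_true_eq] at h
  exact h.1

theorem le_of_settles {d s t : ℕ} {τ : List (Option ℕ)} (hs : settles d s τ = true)
    (ht : CoveredBy d t τ) : s ≤ t := by
  by_contra! hlt
  simp only [settles, Bool.and_eq_true, Bool.or_eq_true, beq_iff_eq, Bool.not_eq_true',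
    decide_eq_false_iff_not] at hs
  rcases hs.2 with h | h
  · omega
  · exact h (ht.mono (by omega))

theorem settles_unique {d s t : ℕ} {τ : List (Option ℕ)} (hs : settles d s τ = true)
    (ht : settles d t τ = true) : s = t :=
  le_antisymm (le_of_settles hs (.of_settles ht)) (le_of_settles ht (.of_settles hs))

theorem exists_settles {d : ℕ} {τ : List (Option ℕ)} (h : ∀ x, some x ∈ τ → x ∈ Wset d) :
    ∃ s, settles d s τ = true := by
  have hex := exists_coveredBy h
  refine ⟨Nat.find hex, ?_⟩
  have hspec := Nat.find_spec hex
  simp only [settles, hspec, decide_true, Bool.true_and, Bool.or_eq_true, beq_iff_eq,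
    Bool.not_eq_true', decide_eq_false_iff_not]
  rcases Nat.eq_zero_or_pos (Nat.find hex) with h0 | h0
  · exact .inl h0
  · exact .inr (Nat.find_min hex (by omega))

theorem primrec_settles :
    Primrec fun p : (ℕ × ℕ) × List (Option ℕ) => settles p.1.1 p.1.2 p.2 := by
  have hs : Primrec fun p : (ℕ × ℕ) × List (Option ℕ) => p.1.2 := Primrec.snd.comp Primrec.fst
  refine Primrec.and.comp primrec_coveredBy (Primrec.or.comp (Primrec.beq.comp hs (.const 0))
    (Primrec.not.comp (primrec_coveredBy.comp (.pair (.pair (Primrec.fst.comp Primrec.fst)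
      (Primrec.nat_sub.comp hs (.const 1))) Primrec.snd))))

/-- The numbers at most `d` occurring in `τ`, in increasing order. -/
def contentUpTo (d : ℕ) (τ : List (Option ℕ)) : List ℕ :=
  (List.range (d + 1)).filter fun x => some x ∈ τ

theorem mem_contentUpTo {d x : ℕ} {τ : List (Option ℕ)} :
    x ∈ contentUpTo d τ ↔ x ≤ d ∧ some x ∈ τ := by
  simp [contentUpTo]

theorem primrec_contentUpTo : Primrec₂ contentUpTo := by
  have h : PrimrecRel fun (x : ℕ) (τ : List (Option ℕ)) => some x ∈ τ := by
    have hR : PrimrecRel fun (o : Option ℕ) (x : ℕ) => o = some x :=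
      Primrec.eq.comp Primrec.fst (Primrec.option_some.comp Primrec.snd)
    exact ((hR.exists_mem_list.comp Primrec.snd Primrec.fst).of_eq fun p => by simp)
  exact (h.listFilter.comp (Primrec.list_range.comp (Primrec.succ.comp Primrec.fst)) Primrec.snd)

/-- There is an injective computable way of replacing `W_d` up to `d` by a finite list. -/
theorem exists_patch : ∃ g : ℕ × List ℕ → ℕ, Computable g ∧ Function.Injective g ∧
    ∀ d F x, x ∈ Wset (g (d, F)) ↔ if x ≤ d then x ∈ F else x ∈ Wset d := by
  let f : (ℕ × List ℕ) × ℕ →. ℕ := fun p =>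
    bif decide (p.2 ≤ p.1.1) then
      (bif decide (p.2 ∈ p.1.2) then Part.some 0 else Part.none)
    else Code.eval (ofNat Code p.1.1) p.2
  have hmem : PrimrecPred fun p : (ℕ × List ℕ) × ℕ => p.2 ∈ p.1.2 := by
    have hR : PrimrecRel fun (y x : ℕ) => y = x := Primrec.eq
    exact (hR.exists_mem_list.comp (Primrec.snd.comp Primrec.fst) Primrec.snd).of_eq
      fun p => by simp
  have hle : PrimrecPred fun p : (ℕ × List ℕ) × ℕ => p.2 ≤ p.1.1 :=
    Primrec.nat_le.comp Primrec.snd (Primrec.fst.comp Primrec.fst)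
  have hf : Partrec f := by
    refine Partrec.cond hle.decide.to_comp (Partrec.cond hmem.decide.to_comp
      (Computable.const 0).partrec Partrec.none) ?_
    exact Code.eval_part.comp ((Computable.ofNat Code).comp
      (Computable.fst.comp Computable.fst)) Computable.snd
  have hf' : Partrec fun n : ℕ => f (ofNat ((ℕ × List ℕ) × ℕ) n) :=
    hf.comp (Computable.ofNat _)
  obtain ⟨c, hc⟩ := Code.exists_code.1 (Partrec.nat_iff.1 hf')
  refine ⟨fun p => encode (Code.curry c (encode p)), ?_, ?_, ?_⟩
  · exact Computable.encode.comp
      (Code.primrec₂_curry.to_comp.comp (Computable.const c) Computable.encode)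
  · intro p q h
    exact encode_injective (Code.curry_inj (encode_injective h)).2
  · intro d F x
    have h : phi (encode (Code.curry c (encode (d, F)))) x = f ((d, F), x) := by
      rw [phi, ofNat_encode, Code.eval_curry, hc]
      change f (ofNat _ (encode ((d, F), x))) = _
      rw [ofNat_encode]
    have h' : x ∈ Wset (encode (Code.curry c (encode (d, F)))) ↔ (f ((d, F), x)).Dom := by
      rw [← h]; rfl
    rw [h']
    by_cases hxd : x ≤ d
    · by_cases hxF : x ∈ F <;> simp [f, hxd, hxF]
    · simp only [f, hxd, decide_false, cond_false, if_false]
      rfl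

/-- At stage `m = ⟨k, s⟩`, the set conjectured by `M` on the prefix of `σ` of length `k` is
first seen, after exactly `s` steps, to cover that prefix. -/
def fires (M : List (Option ℕ) → ℕ) (σ : List (Option ℕ)) (m : ℕ) : Bool :=
  settles (M (σ.take m.unpair.1)) m.unpair.2 (σ.take m.unpair.1)

/-- The length of the prefix handled at the last firing stage up to `n`. -/
def lastFired (M : List (Option ℕ) → ℕ) (σ : List (Option ℕ)) (n : ℕ) : ℕ :=
  Nat.rec (motive := fun _ => ℕ) 0
    (fun y IH => bif fires M σ (y + 1) then (y + 1).unpair.1 else IH) n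

theorem fires_zero (M : List (Option ℕ) → ℕ) (σ : List (Option ℕ)) : fires M σ 0 = true := by
  simp [fires, settles, CoveredBy]

theorem lastFired_of_fires {M : List (Option ℕ) → ℕ} {σ : List (Option ℕ)} {n : ℕ}
    (h : fires M σ n = true) : lastFired M σ n = n.unpair.1 := by
  cases n with
  | zero => simp [lastFired]
  | succ n => simp [lastFired, h]

theorem exists_lastFired_eq {M : List (Option ℕ) → ℕ} {σ : List (Option ℕ)} {m n : ℕ}
    (hmn : m ≤ n) (h : fires M σ m = true) :
    ∃ i, m ≤ i ∧ i ≤ n ∧ fires M σ i = true ∧ lastFired M σ n = i.unpair.1 := by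
  induction n, hmn using Nat.le_induction with
  | base => exact ⟨m, le_rfl, le_rfl, h, lastFired_of_fires h⟩
  | succ n hmn ih =>
    by_cases hn : fires M σ (n + 1) = true
    · exact ⟨n + 1, by omega, le_rfl, hn, lastFired_of_fires hn⟩
    · obtain ⟨i, hi, hin, hf, he⟩ := ih
      exact ⟨i, hi, by omega, hf, by rw [← he]; simp [lastFired, hn]⟩

theorem computable_fires {M : List (Option ℕ) → ℕ} (hM : Computable M) :
    Computable fun p : List (Option ℕ) × ℕ => fires M p.1 p.2 := by
  have htake : Computable fun p : List (Option ℕ) × ℕ => p.1.take p.2.unpair.1 :=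
    (Primrec.list_take.comp (Primrec.fst.comp (Primrec.unpair.comp Primrec.snd))
      Primrec.fst).to_comp
  have hs : Computable fun p : List (Option ℕ) × ℕ => p.2.unpair.2 :=
    (Primrec.snd.comp (Primrec.unpair.comp Primrec.snd)).to_comp
  have h := primrec_settles.to_comp.comp (((hM.comp htake).pair hs).pair htake)
  unfold fires
  exact h

theorem computable_lastFired {M : List (Option ℕ) → ℕ} (hM : Computable M) :
    Computable fun σ => lastFired M σ σ.length := by
  have hy : Computable fun q : List (Option ℕ) × ℕ × ℕ => q.2.1 + 1 :=
    Computable.succ.comp (Computable.fst.comp Computable.snd)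
  have hstep : Computable fun q : List (Option ℕ) × ℕ × ℕ =>
      bif fires M q.1 (q.2.1 + 1) then (q.2.1 + 1).unpair.1 else q.2.2 :=
    have hfires := (computable_fires hM).comp (Computable.fst.pair hy)
    Computable.cond hfires (Computable.fst.comp (Computable.unpair.comp hy))
      (Computable.snd.comp Computable.snd)
  unfold lastFired
  exact Computable.nat_rec Computable.list_length (Computable.const 0) hstep.to₂

theorem pref_take {T : ℕ → Option ℕ} {k n : ℕ} (h : k ≤ n) : (pref T n).take k = pref T k := by
  simp [pref, ← List.map_take, List.take_range, h]

theorem some_mem_pref {T : ℕ → Option ℕ} {n x : ℕ} :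
    some x ∈ pref T n ↔ ∃ i < n, T i = some x := by
  simp [pref]

theorem fires_pref {M : List (Option ℕ) → ℕ} {T : ℕ → Option ℕ} {m n : ℕ} (h : m ≤ n) :
    fires M (pref T n) m =
      settles (M (pref T m.unpair.1)) m.unpair.2 (pref T m.unpair.1) := by
  rw [fires, pref_take ((Nat.unpair_left_le m).trans h)]

/-- The length of the prefix of the text `T` whose conjecture is active at stage `n`. -/
def active (M : List (Option ℕ) → ℕ) (T : ℕ → Option ℕ) (n : ℕ) : ℕ :=
  lastFired M (pref T n) n

theorem active_le (M : List (Option ℕ) → ℕ) (T : ℕ → Option ℕ) (n : ℕ) : active M T n ≤ n := by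
  obtain ⟨i, -, hi, -, he⟩ := exists_lastFired_eq (Nat.zero_le n) (fires_zero M (pref T n))
  exact he.trans_le ((Nat.unpair_left_le i).trans hi)

theorem mem_Wset_of_mem_pref_active {M : List (Option ℕ) → ℕ} {T : ℕ → Option ℕ} {n x : ℕ}
    (hx : some x ∈ pref T (active M T n)) : x ∈ Wset (M (pref T (active M T n))) := by
  obtain ⟨i, -, hi, hf, he⟩ := exists_lastFired_eq (Nat.zero_le n) (fires_zero M (pref T n))
  rw [fires_pref hi, ← he] at hf
  exact (CoveredBy.of_settles hf).mem_Wset hx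

theorem exists_active_eq {M : List (Option ℕ) → ℕ} {T : ℕ → Option ℕ} {k : ℕ}
    (h : ∀ x, some x ∈ pref T k → x ∈ Wset (M (pref T k))) : ∃ n, k ≤ n ∧ active M T n = k := by
  obtain ⟨s, hs⟩ := exists_settles h
  refine ⟨Nat.pair k s, Nat.left_le_pair k s, ?_⟩
  rw [active, lastFired_of_fires, Nat.unpair_pair]
  rw [fires_pref le_rfl, Nat.unpair_pair]
  exact hs

theorem tendsto_active {M : List (Option ℕ) → ℕ} {T : ℕ → Option ℕ}
    (h : {k | ∀ x, some x ∈ pref T k → x ∈ Wset (M (pref T k))}.Infinite) :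
    Tendsto (active M T) atTop atTop := by
  let S := {m : ℕ | settles (M (pref T m.unpair.1)) m.unpair.2 (pref T m.unpair.1) = true}
  have hinj : Set.InjOn (fun m : ℕ => m.unpair.1) S := by
    intro a ha b hb (hab : a.unpair.1 = b.unpair.1)
    simp only [S, Set.mem_ofPred_eq] at ha hb
    rw [← hab] at hb
    rw [← Nat.pair_unpair a, ← Nat.pair_unpair b, ← hab, settles_unique ha hb]
  refine tendsto_atTop.2 fun B => ?_
  have hfin : (S ∩ {m | m.unpair.1 < B}).Finite :=
    Set.Finite.of_finite_image ((Set.finite_lt_nat B).subset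
      (by rintro _ ⟨m, hm, rfl⟩; exact hm.2)) (hinj.mono Set.inter_subset_left)
  obtain ⟨b, hb⟩ := hfin.bddAbove
  obtain ⟨k, hk, hbk⟩ := h.exists_gt b
  obtain ⟨s, hs⟩ := exists_settles hk
  have hkm := Nat.left_le_pair k s
  filter_upwards [eventually_ge_atTop (Nat.pair k s)] with n hn
  have hf : fires M (pref T n) (Nat.pair k s) = true := by
    rw [fires_pref hn, Nat.unpair_pair]
    exact hs
  obtain ⟨i, hi, hin, hfi, he⟩ := exists_lastFired_eq hn hf
  rw [fires_pref hin] at hfi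
  by_contra! hlt
  have : i ≤ b := hb ⟨hfi, he.symm.trans_lt hlt⟩
  omega

/-- If `C` is ConsvPart learnable then `C` is FinApproxConsvPart learnable. -/
theorem stmt10 (C : Set (Set ℕ)) (hC : ∀ L ∈ C, ∃ e, Wset e = L)
    (h : ∃ M : List (Option ℕ) → ℕ, Computable M ∧ PartLearns M C ∧ ConsvLearner M C) :
    ∃ N : List (Option ℕ) → ℕ, Computable N ∧ FinApproxLearns N C ∧
      PartLearns N C ∧ ConsvLearner N C := by
  obtain ⟨M, hM, hpart, hconsv⟩ := h
  obtain ⟨g, hg, hginj, hgmem⟩ := exists_patch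
  let out : List (Option ℕ) → ℕ := fun τ => g (M τ, contentUpTo (M τ) τ)
  have hout : Computable out :=
    hg.comp (hM.pair (primrec_contentUpTo.to_comp.comp hM Computable.id))
  let N : List (Option ℕ) → ℕ := fun σ => out (σ.take (lastFired M σ σ.length))
  have hN : ∀ T n, N (pref T n) = out (pref T (active M T n)) := fun T n => by
    have hlen : (pref T n).length = n := by simp [pref]
    simp only [N, hlen]
    rw [← active, pref_take (active_le M T n)]
  -- The behaviour of `M` and of its active conjectures on a text for a member of `C`.
  have key : ∀ L ∈ C, ∀ T, IsText T L → ∃ e, Wset e = L ∧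
      {n | M (pref T n) = e}.Infinite ∧
      (∀ n, L ⊆ Wset (M (pref T n)) → M (pref T n) = e) ∧
      (∀ d, d ≠ e → ∀ᶠ k in atTop, M (pref T k) ≠ d) ∧
      Tendsto (active M T) atTop atTop ∧
      (∀ k, M (pref T k) = e → ∃ n, k ≤ n ∧ active M T n = k) := by
    intro L hL T hT
    obtain ⟨e, he, heL, hu⟩ := hpart L hL T hT
    have hcov : ∀ k, M (pref T k) = e → ∀ x, some x ∈ pref T k → x ∈ Wset (M (pref T k)) := by
      intro k hk x hx
      obtain ⟨i, -, hi⟩ := some_mem_pref.1 hx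
      rw [hk, heL, ← hT]
      exact ⟨i, hi⟩
    refine ⟨e, heL, he, fun n hn => ?_, fun d hd => ?_, tendsto_active (he.mono hcov),
      fun k hk => exists_active_eq (hcov k hk)⟩
    · obtain ⟨n₀, hn₀⟩ := he.nonempty
      exact (hconsv L hL T hT).unique ⟨⟨n, rfl⟩, hn⟩ ⟨⟨n₀, hn₀⟩, heL.ge⟩
    · have hfin : {n | M (pref T n) = d}.Finite := by
        by_contra hinf
        exact hd (hu d hinf)
      rw [← Nat.cofinite_eq_atTop]
      exact hfin.compl_mem_cofinite
  have hsub : ∀ {L T}, IsText T L → ∀ {k x}, some x ∈ pref T k → x ∈ L := by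
    intro L T hT k x hx
    obtain ⟨i, -, hi⟩ := some_mem_pref.1 hx
    rw [← hT]
    exact ⟨i, hi⟩
  have hcontent : ∀ {L T}, IsText T L → ∀ b, ∀ᶠ k in atTop, ∀ x ≤ b,
      (some x ∈ pref T k ↔ x ∈ L) := by
    intro L T hT b
    refine (Set.finite_le_nat b).eventually_all.2 fun x _ => ?_
    by_cases hx : x ∈ L
    · obtain ⟨i, hi⟩ : ∃ i, T i = some x := by rwa [← hT] at hx
      filter_upwards [eventually_gt_atTop i] with k hk
      exact iff_of_true (some_mem_pref.2 ⟨i, hk, hi⟩) hx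
    · exact .of_forall fun k => iff_of_false (fun h => hx (hsub hT h)) hx
  have hcanon : ∀ {L e}, Wset e = L → ∃ F : List ℕ, Wset (g (e, F)) = L ∧
      (∀ τ, (∀ x ≤ e, (some x ∈ τ ↔ x ∈ L)) → contentUpTo e τ = F) := by
    classical
    intro L e he
    refine ⟨(List.range (e + 1)).filter fun x => x ∈ L, ?_, fun τ hτ => ?_⟩
    · ext x
      rw [hgmem, he]
      by_cases hx : x ≤ e <;> simp [hx]
    · refine List.filter_congr fun x hx => ?_
      simp only [List.mem_range, Nat.lt_succ_iff] at hx
      simp [hτ x hx]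
  refine ⟨N, hout.comp (Primrec.list_take.to_comp.comp (computable_lastFired hM) Computable.id),
    ?_, ?_, ?_⟩
  · intro L hL T hT D
    obtain ⟨e, heL, -, -, hne, hact, -⟩ := key L hL T hT
    obtain ⟨F, hF, hFeq⟩ := hcanon heL
    have hlarge : ∀ᶠ k in atTop, ∀ d ≤ D.sup id, d ≠ e → M (pref T k) ≠ d :=
      (Set.finite_le_nat _).eventually_all.2 fun d _ => by
        by_cases hd : d = e
        · exact .of_forall fun _ h => (h hd).elim
        · exact (hne d hd).mono fun _ h _ => h
    filter_upwards [hact.eventually hlarge, hact.eventually (hcontent hT e),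
      hact.eventually (hcontent hT (D.sup id))] with n h₁ h₂ h₃
    rw [hN]
    by_cases hd : M (pref T (active M T n)) = e
    · simp only [out, hd, hFeq _ h₂, hF]
    · ext x
      simp only [Set.mem_inter_iff, Finset.mem_coe, and_congr_left_iff]
      intro hx
      have hxD : x ≤ D.sup id := Finset.le_sup (f := id) hx
      have hlt : D.sup id < M (pref T (active M T n)) := by
        by_contra! hle
        exact h₁ _ hle hd rfl
      simp only [out]
      rw [hgmem, if_pos (by omega), mem_contentUpTo, h₃ x hxD]
      exact and_iff_right (by omega)
  · intro L hL T hT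
    obtain ⟨e, heL, he, -, hne, hact, hhit⟩ := key L hL T hT
    obtain ⟨F, hF, hFeq⟩ := hcanon heL
    obtain ⟨k₀, hk₀⟩ := eventually_atTop.1 (hcontent hT e)
    refine ⟨g (e, F), ?_, hF, fun c hc => ?_⟩
    · refine Set.infinite_of_forall_exists_gt fun b => ?_
      obtain ⟨k, hk, hbk⟩ := he.exists_gt (max b k₀)
      obtain ⟨n, hkn, hn⟩ := hhit k hk
      refine ⟨n, ?_, by omega⟩
      simp only [Set.mem_ofPred_eq] at hk ⊢
      simp only [hN, hn, out, hk, hFeq _ (hk₀ k (by omega))]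
    · obtain ⟨n₁, hn₁⟩ := hc.nonempty
      simp only [Set.mem_ofPred_eq, hN, out] at hn₁
      set d := M (pref T (active M T n₁)) with hd
      have hfreq : ∃ᶠ n in atTop, N (pref T n) = c := Nat.frequently_atTop_iff_infinite.2 hc
      have hde : d = e := by
        by_contra hdne
        obtain ⟨n, hn, hn'⟩ := (hfreq.and_eventually (hact.eventually (hne d hdne))).exists
        rw [hN, ← hn₁] at hn
        exact hn' (Prod.ext_iff.1 (hginj hn)).1
      obtain ⟨n, hn, hn'⟩ := (hfreq.and_eventually (hact.eventually (hcontent hT e))).exists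
      rw [hN] at hn
      have hMe : M (pref T (active M T n)) = e :=
        (Prod.ext_iff.1 (hginj (hn.trans hn₁.symm))).1.trans hde
      simp only [out, hMe, hFeq _ hn'] at hn
      exact hn.symm
  · intro L hL T hT
    obtain ⟨e, heL, he, hcons, -, hact, hhit⟩ := key L hL T hT
    obtain ⟨F, hF, hFeq⟩ := hcanon heL
    obtain ⟨k₀, hk₀⟩ := eventually_atTop.1 (hcontent hT e)
    refine ⟨g (e, F), ⟨?_, hF.ge⟩, ?_⟩
    · obtain ⟨k, hk, hbk⟩ := he.exists_gt k₀
      obtain ⟨n, -, hn⟩ := hhit k hk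
      refine ⟨n, ?_⟩
      simp only [Set.mem_ofPred_eq] at hk
      simp only [hN, hn, out, hk, hFeq _ (hk₀ k hbk.le)]
    · rintro _ ⟨⟨n, rfl⟩, hn⟩
      rw [hN] at hn ⊢
      have hsmall : ∀ x ∈ L, x ≤ M (pref T (active M T n)) →
          some x ∈ pref T (active M T n) := by
        intro x hx hxd
        have := hn hx
        rw [hgmem, if_pos hxd] at this
        exact (mem_contentUpTo.1 this).2
      have hMe : M (pref T (active M T n)) = e := by
        refine hcons _ fun x hx => ?_
        by_cases hxd : x ≤ M (pref T (active M T n))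
        · exact mem_Wset_of_mem_pref_active (hsmall x hx hxd)
        · have := hn hx
          rwa [hgmem, if_neg hxd] at this
      simp only [hMe] at hsmall
      simp only [out, hMe]
      rw [hFeq _ fun x hx => ⟨hsub hT, fun h => hsmall x h hx⟩]
end

section
/- If a class C of r.e. sets is confidently partially (ConfPart) learnable, then there is a single learner which simultaneously finitely approximately (FinApprox) learns C and confidently partially (ConfPart) learns C. -/
open Filter

/-- The characteristic list of the content of `σ` on `{0, ..., e}`. -/
def contentBits (e : ℕ) (σ : List (Option ℕ)) : List Bool :=
  (List.range (e + 1)).map fun x => decide (some x ∈ σ)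

theorem contentBits_primrec : Primrec₂ contentBits := by
  refine Primrec.list_map
    (Primrec.list_range.comp (Primrec.succ.comp Primrec.fst)) ?_
  have hex : PrimrecRel fun (σ : List (Option ℕ)) (x : ℕ) => ∃ a ∈ σ, a = some x :=
    PrimrecRel.exists_mem_list
      (Primrec.eq.comp Primrec.fst (Primrec.option_some.comp Primrec.snd))
  have hmem : PrimrecPred fun q : (ℕ × List (Option ℕ)) × ℕ => some q.2 ∈ q.1.2 :=
    (hex.comp (Primrec.snd.comp Primrec.fst) Primrec.snd).of_eq fun q => by simp
  exact Primrec.to₂ hmem.decide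

theorem contentBits_getElem?_of_le {e x : ℕ} (hx : x ≤ e) (σ : List (Option ℕ)) :
    (contentBits e σ)[x]? = some (decide (some x ∈ σ)) := by
  simp [contentBits, Nat.lt_succ_of_le hx]

theorem contentBits_getElem?_of_lt {e x : ℕ} (hx : e < x) (σ : List (Option ℕ)) :
    (contentBits e σ)[x]? = none := by
  simp [contentBits]
  omega

theorem contentBits_congr {e : ℕ} {σ τ : List (Option ℕ)}
    (h : ∀ x ≤ e, (some x ∈ σ ↔ some x ∈ τ)) : contentBits e σ = contentBits e τ := by
  refine List.map_congr_left fun x hx => ?_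
  have hx' : x ≤ e := Nat.lt_succ_iff.mp (List.mem_range.mp hx)
  simp [h x hx']

/-- The partial function whose domain follows `l` where `l` is defined and `W_e` elsewhere. -/
def patchFun (p : ℕ × List Bool) (x : ℕ) : Part ℕ :=
  bif p.2[x]?.isSome then bif p.2[x]?.getD false then Part.some 0 else Part.none else phi p.1 x

theorem patchFun_partrec : Partrec₂ patchFun := by
  have hphi : Partrec fun q : (ℕ × List Bool) × ℕ => phi q.1.1 q.2 :=
    Nat.Partrec.Code.eval_part.comp
      ((Computable.ofNat _).comp (Computable.fst.comp Computable.fst)) Computable.snd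
  have hget : Primrec fun q : (ℕ × List Bool) × ℕ => q.1.2[q.2]? :=
    Primrec.list_getElem?.comp (Primrec.snd.comp Primrec.fst) Primrec.snd
  exact Partrec.cond (Primrec.option_isSome.comp hget).to_comp
    (Partrec.cond (Primrec.option_getD.comp hget (Primrec.const false)).to_comp
      (Computable.const 0) Partrec.none) hphi

/-- There is an injective computable operator producing indices of the patched sets. -/
theorem exists_patch_index : ∃ g : ℕ × List Bool → ℕ, Computable g ∧ Function.Injective g ∧
    ∀ p x, x ∈ Wset (g p) ↔ (patchFun p x).Dom := by
  obtain ⟨c, hc⟩ := Nat.Partrec.Code.exists_code.1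
    (show Nat.Partrec _ from patchFun_partrec)
  refine ⟨fun p => Encodable.encode (c.curry (Encodable.encode p)), ?_, ?_, ?_⟩
  · exact Computable.encode.comp ((Nat.Partrec.Code.primrec₂_curry.comp (Primrec.const c)
      Primrec.encode).to_comp)
  · intro p q hpq
    exact Encodable.encode_injective
      (Nat.Partrec.Code.curry_inj (Encodable.encode_injective hpq)).2
  · intro p x
    have hpair : Encodable.decode (α := (ℕ × List Bool) × ℕ)
        (Nat.pair (Encodable.encode p) x) = some (p, x) := by
      simp
    rw [Wset, PFun.mem_dom, ← Part.dom_iff_mem]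
    simp [phi, Nat.Partrec.Code.eval_curry, hc, hpair]

theorem mem_pref {T : ℕ → Option ℕ} {n x : ℕ} :
    some x ∈ pref T n ↔ ∃ m < n, T m = some x := by
  simp [pref]

theorem eventually_mem_pref_iff (T : ℕ → Option ℕ) (x : ℕ) :
    ∀ᶠ n in atTop, (some x ∈ pref T n ↔ ∃ m, T m = some x) := by
  by_cases h : ∃ m, T m = some x
  · obtain ⟨m, hm⟩ := h
    filter_upwards [eventually_gt_atTop m] with n hn
    exact ⟨fun _ => ⟨m, hm⟩, fun _ => mem_pref.2 ⟨m, hn, hm⟩⟩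
  · refine Eventually.of_forall fun n => ⟨fun hx => ?_, fun hx => absurd hx h⟩
    obtain ⟨m, -, hm⟩ := mem_pref.1 hx
    exact ⟨m, hm⟩

theorem eventually_forall_mem_pref_iff (T : ℕ → Option ℕ) (d : ℕ) :
    ∀ᶠ n in atTop, ∀ x ≤ d, (some x ∈ pref T n ↔ ∃ m, T m = some x) :=
  (Set.finite_Iic d).eventually_all.2 fun x _ => eventually_mem_pref_iff T x

theorem exists_eventually_contentBits_eq (T : ℕ → Option ℕ) (e : ℕ) :
    ∃ l, (∀ᶠ n in atTop, contentBits e (pref T n) = l) ∧ ∃ n, l = contentBits e (pref T n) ∧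
      ∀ x ≤ e, (some x ∈ pref T n ↔ ∃ m, T m = some x) := by
  have h := eventually_forall_mem_pref_iff T e
  obtain ⟨k, hk⟩ := h.exists
  refine ⟨contentBits e (pref T k), ?_, k, rfl, hk⟩
  filter_upwards [h] with n hn
  exact contentBits_congr fun x hx => (hn x hx).trans (hk x hx).symm

section PatchedLearner

variable {M : List (Option ℕ) → ℕ} {g : ℕ × List Bool → ℕ} {T : ℕ → Option ℕ}

/-- Replaces each hypothesis `e` of `M` by its patch along the content on `{0, ..., e}`. -/
def patchedLearner (g : ℕ × List Bool → ℕ) (M : List (Option ℕ) → ℕ) (σ : List (Option ℕ)) : ℕ :=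
  g (M σ, contentBits (M σ) σ)

theorem patchedLearner_computable (hg : Computable g) (hM : Computable M) :
    Computable (patchedLearner g M) :=
  hg.comp (hM.pair (contentBits_primrec.to_comp.comp hM Computable.id))

theorem infinite_patchedLearner_of_infinite {e : ℕ} {l : List Bool}
    (he : {n | M (pref T n) = e}.Infinite)
    (hl : ∀ᶠ n in atTop, contentBits e (pref T n) = l) :
    {n | patchedLearner g M (pref T n) = g (e, l)}.Infinite := by
  rw [← Nat.frequently_atTop_iff_infinite] at he ⊢
  refine (he.and_eventually hl).mono ?_
  rintro n ⟨rfl, h⟩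
  simp [patchedLearner, h]

theorem eq_of_infinite_patchedLearner (hg : Function.Injective g) {e d : ℕ} {l : List Bool}
    (huniq : ∀ d, {n | M (pref T n) = d}.Infinite → d = e)
    (hl : ∀ᶠ n in atTop, contentBits e (pref T n) = l)
    (hd : {n | patchedLearner g M (pref T n) = d}.Infinite) : d = g (e, l) := by
  obtain ⟨k, hk : patchedLearner g M (pref T k) = d⟩ := hd.nonempty
  have hMk : M (pref T k) = e := by
    refine huniq _ (hd.mono fun n hn => ?_)
    exact (Prod.ext_iff.1 (hg (hn.trans hk.symm))).1
  rw [← Nat.frequently_atTop_iff_infinite] at hd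
  obtain ⟨n, hn, hnl⟩ := (hd.and_eventually hl).exists
  have hMn : M (pref T n) = e :=
    (Prod.ext_iff.1 (hg (hn.trans hk.symm))).1.trans hMk
  rw [← hn, patchedLearner, hMn, hnl]

end PatchedLearner

theorem mem_wset_patch_of_le {g : ℕ × List Bool → ℕ}
    (hW : ∀ p x, x ∈ Wset (g p) ↔ (patchFun p x).Dom) {e x : ℕ} (hx : x ≤ e)
    (σ : List (Option ℕ)) : x ∈ Wset (g (e, contentBits e σ)) ↔ some x ∈ σ := by
  rw [hW]
  by_cases hm : some x ∈ σ <;> simp [patchFun, contentBits_getElem?_of_le hx, hm]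

theorem wset_patch_of_correct {g : ℕ × List Bool → ℕ}
    (hW : ∀ p x, x ∈ Wset (g p) ↔ (patchFun p x).Dom) {e : ℕ} {σ : List (Option ℕ)}
    (h : ∀ x ≤ e, (some x ∈ σ ↔ x ∈ Wset e)) : Wset (g (e, contentBits e σ)) = Wset e := by
  ext x
  rcases le_or_gt x e with hx | hx
  · rw [mem_wset_patch_of_le hW hx, h x hx]
  · rw [hW]
    simp [patchFun, contentBits_getElem?_of_lt hx, Wset, PFun.mem_dom, Part.dom_iff_mem]

/-- If `C` is ConfPart learnable then `C` is FinApproxConfPart learnable. -/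
theorem stmt11 (C : Set (Set ℕ)) (hC : ∀ L ∈ C, ∃ e, Wset e = L)
    (h : ∃ M : List (Option ℕ) → ℕ, Computable M ∧ PartLearns M C ∧ Confident M) :
    ∃ N : List (Option ℕ) → ℕ, Computable N ∧ FinApproxLearns N C ∧
      PartLearns N C ∧ Confident N := by
  obtain ⟨M, hM, hpart, hconf⟩ := h
  obtain ⟨g, hg, hinj, hW⟩ := exists_patch_index
  refine ⟨patchedLearner g M, patchedLearner_computable hg hM, ?_, ?_, ?_⟩
  · intro L hL T hT D
    obtain ⟨e, -, heL, huniq⟩ := hpart L hL T hT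
    have hTL : ∀ x, (∃ m, T m = some x) ↔ x ∈ L := fun x => Set.ext_iff.1 hT x
    have hsmall : ∀ᶠ n in atTop, ∀ d < D.sup id, d ≠ e → M (pref T n) ≠ d := by
      refine (Set.finite_Iio (D.sup id)).eventually_all.2 fun d _ => ?_
      by_cases hde : d = e
      · exact Eventually.of_forall fun n hne => absurd hde hne
      · have hfin : ¬ ∃ᶠ n in atTop, M (pref T n) = d := fun hfr =>
          hde (huniq d (Nat.frequently_atTop_iff_infinite.1 hfr))
        exact (not_frequently.1 hfin).mono fun n hn _ => hn
    filter_upwards [hsmall, eventually_forall_mem_pref_iff T e,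
      eventually_forall_mem_pref_iff T (D.sup id)] with n hn hne hnD
    by_cases hMe : M (pref T n) = e
    · have hcorrect : Wset (g (e, contentBits e (pref T n))) = Wset e :=
        wset_patch_of_correct hW fun x hx => by rw [hne x hx, hTL, heL]
      rw [patchedLearner, hMe, hcorrect, heL]
    · have hle : D.sup id ≤ M (pref T n) := by
        by_contra! hlt
        exact hn _ hlt hMe rfl
      ext x
      refine and_congr_left fun hxD => ?_
      have hx : x ≤ D.sup id := Finset.le_sup (f := id) hxD
      rw [patchedLearner, mem_wset_patch_of_le hW (hx.trans hle), hnD x hx, hTL]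
  · intro L hL T hT
    obtain ⟨e, hinf, heL, huniq⟩ := hpart L hL T hT
    obtain ⟨l, hl, k, rfl, hk⟩ := exists_eventually_contentBits_eq T e
    refine ⟨_, infinite_patchedLearner_of_infinite hinf hl, ?_,
      fun d hd => eq_of_infinite_patchedLearner hinj huniq hl hd⟩
    rw [wset_patch_of_correct hW fun x hx => ?_, heL]
    rw [hk x hx, heL]
    exact Set.ext_iff.1 hT x
  · intro T
    obtain ⟨e, hinf, huniq⟩ := hconf T
    obtain ⟨l, hl, -⟩ := exists_eventually_contentBits_eq T e
    exact ⟨_, infinite_patchedLearner_of_infinite hinf hl,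
      fun d hd => eq_of_infinite_patchedLearner hinj huniq hl hd⟩
end

section
/- There exists a uniformly r.e. family C of subsets of ℕ such that C is approximately (Approx) learnable, but C is not class-preservingly finitely approximately (ClsPresvFinApprox) learnable: there is no uniformly r.e. family (H_i)_{i∈ℕ} with {H_i : i ∈ ℕ} = C together with a learner M such that for every L ∈ C, every text T for L, and every finite set D ⊆ ℕ, for almost all n, H_{M(T[n])} ∩ D = L ∩ D. -/
open Filter

/-- A family `H` of subsets of ℕ is uniformly r.e. if the set of codes
`⟨i,x⟩` with `x ∈ H i` is recursively enumerable, i.e. equals some `W_e`. -/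
def UniformlyRE (H : ℕ → Set ℕ) : Prop :=
  ∃ e, Wset e = {p : ℕ | (Nat.unpair p).2 ∈ H (Nat.unpair p).1}

open Nat.Partrec (Code)
open Nat.Partrec.Code (eval evaln)

namespace ApproxSeparation

/-- The sequence `y_k, …, y_k` of length `n + 1`, where `y_k = ⟨e, k + 1⟩`. -/
def block (e k n : ℕ) : List (Option ℕ) :=
  (List.range (n + 1)).map fun _ => some (Nat.pair e (k + 1))

/-- For `p = ⟨n, t⟩`, test whether the learner coded by `e`, after reading `σ` and `n + 1` copies
of `y_k`, conjectures a set that contains `y_k` and `⟨e, z⟩` after `t` steps of enumeration. -/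
def test (e z k : ℕ) (σ : List (Option ℕ)) (p : ℕ) : Part Bool :=
  (eval (Denumerable.ofNat Code e.unpair.2)
      (Encodable.encode (σ ++ block e k p.unpair.1))).map fun i =>
    (evaln p.unpair.2 (Denumerable.ofNat Code e.unpair.1)
        (Nat.pair i (Nat.pair e (k + 1)))).isSome &&
      (evaln p.unpair.2 (Denumerable.ofNat Code e.unpair.1)
        (Nat.pair i (Nat.pair e z))).isSome

/-- Search for an extension of `σ` by copies of `y_k` that passes the test. -/
def advance (e z k : ℕ) (σ : List (Option ℕ)) : Part (List (Option ℕ)) :=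
  (Nat.rfind (test e z k σ)).map fun p => σ ++ block e k p.unpair.1

/-- The finite sequence built after `k` successful searches for `⟨e, 0⟩`. -/
def hist (e : ℕ) : ℕ → Part (List (Option ℕ))
  | 0 => Part.some []
  | k + 1 => (hist e k).bind (advance e 0 k)

/-- The partial function whose domain is the set with index `⟨e, c⟩`, viewed inside column `e`. -/
def semidecide (e c x : ℕ) : Part (List (Option ℕ)) :=
  bif c == 0 then (bif x == 0 then Part.none else hist e x)
  else bif x == 0 then (hist e (c - 1)).bind (advance e c (c - 1))
  else bif decide (x ≤ c) then hist e (c - 1) else Part.none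

/-- The diagonal family. -/
def family (i : ℕ) : Set ℕ :=
  {x | x.unpair.1 = i.unpair.1 ∧ (semidecide i.unpair.1 i.unpair.2 x.unpair.2).Dom}

section Computability

open Primrec

variable {α : Type*} [Primcodable α] {e z k i t n c x p : α → ℕ} {σ : α → List (Option ℕ)}

theorem primrec_block (he : Primrec e) (hk : Primrec k) (hn : Primrec n) :
    Primrec fun a => block (e a) (k a) (n a) :=
  list_map (list_range.comp (succ.comp hn))
    (option_some.comp (Primrec₂.natPair.comp (he.comp fst) (succ.comp (hk.comp fst)))).to₂

theorem primrec_append_block (he : Primrec e) (hk : Primrec k) (hσ : Primrec σ) (hn : Primrec n) :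
    Primrec fun a => σ a ++ block (e a) (k a) (n a) :=
  list_append.comp hσ (primrec_block he hk hn)

theorem primrec_evaln_isSome (ht : Primrec t) (hc : Primrec c) (hx : Primrec x) :
    Primrec fun a => (evaln (t a) (Denumerable.ofNat Code (c a)) (x a)).isSome :=
  option_isSome.comp (Nat.Partrec.Code.primrec_evaln.comp
    ((ht.pair ((Primrec.ofNat Code).comp hc)).pair hx))

theorem primrec_evaln_pair_isSome (ht : Primrec t) (he : Primrec e) (hi : Primrec i)
    (hz : Primrec z) :
    Primrec fun a => (evaln (t a) (Denumerable.ofNat Code (e a).unpair.1)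
      (Nat.pair (i a) (Nat.pair (e a) (z a)))).isSome :=
  primrec_evaln_isSome ht (fst.comp (unpair.comp he))
    (Primrec₂.natPair.comp hi (Primrec₂.natPair.comp he hz))

theorem partrec_test (he : Primrec e) (hz : Primrec z) (hk : Primrec k) (hσ : Primrec σ)
    (hp : Primrec p) : Partrec fun a => test (e a) (z a) (k a) (σ a) (p a) := by
  have hn : Primrec fun a => (p a).unpair.1 := fst.comp (unpair.comp hp)
  have ht : Primrec fun b : α × ℕ => (p b.1).unpair.2 := snd.comp (unpair.comp (hp.comp fst))
  have hk1 : Primrec fun b : α × ℕ => k b.1 + 1 := succ.comp (hk.comp fst)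
  have hpass := Primrec.and.comp (primrec_evaln_pair_isSome ht (he.comp fst) snd hk1)
    (primrec_evaln_pair_isSome ht (he.comp fst) snd (hz.comp fst))
  have hcode : Primrec fun a => Denumerable.ofNat Code (e a).unpair.2 :=
    (Primrec.ofNat Code).comp (snd.comp (unpair.comp he))
  have heval := Nat.Partrec.Code.eval_part.comp hcode.to_comp
    (Primrec.encode.comp (primrec_append_block he hk hσ hn)).to_comp
  exact heval.map hpass.to_comp.to₂

theorem partrec_advance (he : Primrec e) (hz : Primrec z) (hk : Primrec k) (hσ : Primrec σ) :
    Partrec fun a => advance (e a) (z a) (k a) (σ a) := by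
  have hfind : Partrec fun a => Nat.rfind (test (e a) (z a) (k a) (σ a)) :=
    Partrec.rfind (p := fun a => test (e a) (z a) (k a) (σ a))
      (partrec_test (he.comp fst) (hz.comp fst) (hk.comp fst) (hσ.comp fst) snd)
  exact hfind.map (primrec_append_block (he.comp fst) (hk.comp fst) (hσ.comp fst)
    (fst.comp (unpair.comp snd))).to_comp.to₂

theorem partrec_hist (he : Primrec e) (hk : Primrec k) : Partrec fun a => hist (e a) (k a) := by
  have hstep : Partrec fun b : α × ℕ × List (Option ℕ) => advance (e b.1) 0 b.2.1 b.2.2 :=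
    partrec_advance (he.comp fst) (Primrec.const 0) (fst.comp snd) (snd.comp snd)
  refine (Partrec.nat_rec (g := fun _ => Part.some ([] : List (Option ℕ))) hk.to_comp
    (Computable.const []) hstep.to₂).of_eq fun a => ?_
  induction k a with
  | zero => rfl
  | succ k ih => exact congrArg (fun s => s.bind (advance (e a) 0 k)) ih

theorem partrec_semidecide (he : Primrec e) (hc : Primrec c) (hx : Primrec x) :
    Partrec fun a => semidecide (e a) (c a) (x a) := by
  have hk : Primrec fun a => c a - 1 := pred.comp hc
  have hhist : Partrec fun a => hist (e a) (c a - 1) := partrec_hist he hk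
  have hadv : Partrec fun b : α × List (Option ℕ) => advance (e b.1) (c b.1) (c b.1 - 1) b.2 :=
    partrec_advance (he.comp fst) (hc.comp fst) (hk.comp fst) snd
  have hc0 := (Primrec.beq.comp hc (Primrec.const 0)).to_comp
  have hx0 := (Primrec.beq.comp hx (Primrec.const 0)).to_comp
  exact Partrec.cond hc0 (Partrec.cond hx0 Partrec.none (partrec_hist he hx))
    (Partrec.cond hx0 (hhist.bind hadv.to₂)
      (Partrec.cond (Primrec.nat_le.comp hx hc).decide.to_comp hhist Partrec.none))

theorem exists_Wset_eq_dom {f : ℕ →. α} (hf : Partrec f) :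
    ∃ e, Wset e = {x | (f x).Dom} := by
  obtain ⟨c, hc⟩ := Nat.Partrec.Code.exists_code.1
    (Partrec.nat_iff.1 (hf.map (Computable.encode.comp Computable.snd).to₂))
  refine ⟨Encodable.encode c, ?_⟩
  ext x
  simp [Wset, phi, hc, PFun.Dom]

theorem uniformlyRE_family : UniformlyRE family := by
  have hi : Primrec fun p : ℕ => p.unpair.1.unpair := unpair.comp (fst.comp unpair)
  have hx : Primrec fun p : ℕ => p.unpair.2.unpair := unpair.comp (snd.comp unpair)
  have hf : Partrec fun p : ℕ =>
      bif p.unpair.2.unpair.1 == p.unpair.1.unpair.1 then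
        semidecide p.unpair.1.unpair.1 p.unpair.1.unpair.2 p.unpair.2.unpair.2
      else Part.none :=
    Partrec.cond (Primrec.beq.comp (fst.comp hx) (fst.comp hi)).to_comp
      (partrec_semidecide (fst.comp hi) (snd.comp hi) (snd.comp hx)) Partrec.none
  obtain ⟨e, he⟩ := exists_Wset_eq_dom hf
  refine ⟨e, he.trans ?_⟩
  ext p
  by_cases h : p.unpair.2.unpair.1 = p.unpair.1.unpair.1 <;> simp [family, h, beq_eq_false_iff_ne.2]

/-- Some computable learner always conjectures exactly the data seen so far. -/
theorem exists_content_learner :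
    ∃ M : List (Option ℕ) → ℕ, Computable M ∧ ∀ σ, Wset (M σ) = {x | some x ∈ σ} := by
  have hl : Primrec fun p : ℕ => Denumerable.ofNat (List (Option ℕ)) p.unpair.1 :=
    (Primrec.ofNat _).comp (fst.comp unpair)
  have hmem := (Primrec.nat_lt.comp
    (list_idxOf.comp (option_some.comp (snd.comp unpair)) hl) (list_length.comp hl)).decide
  have hf := Partrec.cond hmem.to_comp (Computable.const 0) Partrec.none
  obtain ⟨c, hc⟩ := Nat.Partrec.Code.exists_code.1 (Partrec.nat_iff.1 hf)
  refine ⟨fun σ => Encodable.encode (Nat.Partrec.Code.curry c (Encodable.encode σ)),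
    (Primrec.encode.comp
      (Nat.Partrec.Code.primrec₂_curry.comp (Primrec.const c) Primrec.encode)).to_comp,
    fun σ => ?_⟩
  ext x
  by_cases h : some x ∈ σ
  · simp [Wset, phi, PFun.Dom, Nat.Partrec.Code.eval_curry, hc, h, List.idxOf_lt_length_iff]
  · simp [Wset, phi, PFun.Dom, Nat.Partrec.Code.eval_curry, hc, h, List.idxOf_lt_length_iff]

end Computability

theorem mem_block {e k n : ℕ} {o : Option ℕ} :
    o ∈ block e k n ↔ o = some (Nat.pair e (k + 1)) := by
  simp only [block, List.mem_map, List.mem_range]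
  exact ⟨fun ⟨_, _, h⟩ => h.symm, fun h => ⟨0, by omega, h.symm⟩⟩

theorem hist_dom_of_le {e j k : ℕ} (hjk : j ≤ k) (hk : (hist e k).Dom) : (hist e j).Dom := by
  induction k, hjk using Nat.le_induction with
  | base => exact hk
  | succ k _ ih => exact ih (Part.Dom.of_bind hk)

theorem exists_append_block {e z k : ℕ} {σ τ : List (Option ℕ)} (h : τ ∈ advance e z k σ) :
    ∃ n, τ = σ ++ block e k n := by
  obtain ⟨p, -, rfl⟩ := (Part.mem_map_iff _).1 h
  exact ⟨_, rfl⟩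

theorem mem_of_mem_hist {e k : ℕ} {σ : List (Option ℕ)} (hσ : σ ∈ hist e k) (o : Option ℕ) :
    o ∈ σ ↔ ∃ j < k, o = some (Nat.pair e (j + 1)) := by
  induction k generalizing σ with
  | zero => simp [Part.mem_some_iff.1 hσ]
  | succ k ih =>
    obtain ⟨τ, hτ, h⟩ := Part.mem_bind_iff.1 hσ
    obtain ⟨n, rfl⟩ := exists_append_block h
    simp only [List.mem_append, ih hτ, mem_block, Nat.lt_succ_iff_lt_or_eq, or_and_right,
      exists_or, exists_eq_left]

theorem mem_family_zero {e j : ℕ} :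
    Nat.pair e (j + 1) ∈ family (Nat.pair e 0) ↔ (hist e (j + 1)).Dom := by
  simp [family, semidecide]

theorem zero_notMem_family_zero {e : ℕ} : Nat.pair e 0 ∉ family (Nat.pair e 0) := by
  simp [family, semidecide]

theorem mem_family_succ {e j k : ℕ} :
    Nat.pair e (j + 1) ∈ family (Nat.pair e (k + 1)) ↔ j ≤ k ∧ (hist e k).Dom := by
  by_cases h : j ≤ k <;> simp [family, semidecide, h]

theorem zero_mem_family_succ {e k : ℕ} {σ : List (Option ℕ)} (hσ : σ ∈ hist e k) :
    Nat.pair e 0 ∈ family (Nat.pair e (k + 1)) ↔ (advance e (k + 1) k σ).Dom := by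
  simp [family, semidecide, Part.eq_some_iff.2 hσ]

theorem exists_eq_pair {x e : ℕ} (h : x.unpair.1 = e) : ∃ c, x = Nat.pair e c :=
  ⟨x.unpair.2, by rw [← h, Nat.pair_unpair]⟩

/-- If the searches get stuck at stage `k`, only one index yields a set containing `y_k`. -/
theorem eq_of_mem_family {e k i : ℕ} (hk : ¬ (hist e (k + 1)).Dom)
    (hi : Nat.pair e (k + 1) ∈ family i) : i = Nat.pair e (k + 1) := by
  obtain ⟨c, rfl⟩ : ∃ c, i = Nat.pair e c := exists_eq_pair (by simpa using hi.1.symm)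
  cases c with
  | zero => exact absurd (mem_family_zero.1 hi) hk
  | succ m =>
    obtain ⟨hle, hdom⟩ := mem_family_succ.1 hi
    rcases hle.eq_or_lt with rfl | hlt
    · rfl
    · exact absurd (hist_dom_of_le hlt hdom) hk

theorem infinite_compl_family (i : ℕ) : (family i)ᶜ.Infinite := by
  refine Set.infinite_of_injective_forall_mem (f := fun x => Nat.pair (i.unpair.1 + 1) x)
    (fun x y h => (Nat.pair_eq_pair.1 h).2) fun x hx => ?_
  have := hx.1
  simp at this

theorem mem_pref {T : ℕ → Option ℕ} {n : ℕ} {o : Option ℕ} : o ∈ pref T n ↔ ∃ m < n, T m = o := by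
  simp [pref]

/-- A learner conjecturing the data seen so far approximates every coinfinite set. -/
theorem approxLearns_of_content {M : List (Option ℕ) → ℕ} (hM : ∀ σ, Wset (M σ) = {x | some x ∈ σ})
    {C : Set (Set ℕ)} (hC : ∀ L ∈ C, Lᶜ.Infinite) : ApproxLearns M C := by
  intro L hL
  refine ⟨Lᶜ, hC L hL, fun T hT V hV => ?_⟩
  have hfin : (L ∩ V).Finite := hV.subset fun x hx => Or.inl ⟨hx.2, fun h => h hx.1⟩
  have hseen : ∀ x ∈ L ∩ V, ∀ᶠ n in atTop, some x ∈ pref T n := by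
    rintro x ⟨hx, -⟩
    rw [← hT] at hx
    obtain ⟨m, hm⟩ := hx
    filter_upwards [eventually_gt_atTop m] with n hn
    exact mem_pref.2 ⟨m, hn, hm⟩
  filter_upwards [(eventually_all_finite hfin).2 hseen] with n hn
  ext x
  rw [hM]
  refine ⟨fun hx => ⟨?_, hx.2⟩, fun hx => ⟨hn x hx, hx.2⟩⟩
  obtain ⟨m, -, hm⟩ := mem_pref.1 hx.1
  exact hT ▸ ⟨m, hm⟩

theorem pref_of_getElem? {T : ℕ → Option ℕ} {σ : List (Option ℕ)}
    (h : ∀ n < σ.length, σ[n]? = some (T n)) : pref T σ.length = σ := by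
  refine List.ext_getElem (by simp [pref]) fun n h₁ h₂ => ?_
  have := h n h₂
  rw [List.getElem?_eq_getElem h₂] at this
  simpa [pref] using (Option.some.inj this).symm

section Diagonalization

variable {H : ℕ → Set ℕ} {M : List (Option ℕ) → ℕ} {e : ℕ}

/-- `e = ⟨h, m⟩` where `h` codes the hypothesis space `H` and `m` codes the learner `M`. -/
structure Codes (H : ℕ → Set ℕ) (M : List (Option ℕ) → ℕ) (e : ℕ) : Prop where
  space : ∀ i x, x ∈ H i ↔ (eval (Denumerable.ofNat Code e.unpair.1) (Nat.pair i x)).Dom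
  learner : ∀ σ, eval (Denumerable.ofNat Code e.unpair.2) (Encodable.encode σ) = Part.some (M σ)

theorem exists_codes (hH : UniformlyRE H) (hM : Computable M) : ∃ e, Codes H M e := by
  obtain ⟨h, hh⟩ := hH
  obtain ⟨c, hc⟩ := Nat.Partrec.Code.exists_code.1 hM
  refine ⟨Nat.pair h (Encodable.encode c), fun i x => ?_, fun σ => ?_⟩
  · have := Set.ext_iff.1 hh (Nat.pair i x)
    simp only [Set.mem_ofPred_eq, Nat.unpair_pair] at this ⊢
    exact this.symm
  · simp [hc]

theorem dom_iff_exists_evaln_isSome {c : Code} {x : ℕ} :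
    (eval c x).Dom ↔ ∃ t, (evaln t c x).isSome := by
  simp only [Part.dom_iff_mem, Nat.Partrec.Code.evaln_complete, Option.isSome_iff_exists]
  exact exists_comm

theorem evaln_isSome_mono {c : Code} {x s t : ℕ} (hst : s ≤ t) (h : (evaln s c x).isSome) :
    (evaln t c x).isSome := by
  obtain ⟨y, hy⟩ := Option.isSome_iff_exists.1 h
  exact Option.isSome_iff_exists.2 ⟨y, Nat.Partrec.Code.evaln_mono hst hy⟩

theorem Codes.of_mem_advance (hc : Codes H M e) {z k : ℕ} {σ τ : List (Option ℕ)}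
    (h : τ ∈ advance e z k σ) : Nat.pair e (k + 1) ∈ H (M τ) ∧ Nat.pair e z ∈ H (M τ) := by
  obtain ⟨p, hp, rfl⟩ := (Part.mem_map_iff _).1 h
  have hp := Nat.rfind_spec hp
  rw [test, hc.learner, Part.map_some, Part.mem_some_iff, eq_comm, Bool.and_eq_true] at hp
  simp only [hc.space]
  exact ⟨dom_iff_exists_evaln_isSome.2 ⟨_, hp.1⟩, dom_iff_exists_evaln_isSome.2 ⟨_, hp.2⟩⟩

theorem Codes.advance_dom (hc : Codes H M e) {z k n : ℕ} {σ : List (Option ℕ)}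
    (hy : Nat.pair e (k + 1) ∈ H (M (σ ++ block e k n)))
    (hz : Nat.pair e z ∈ H (M (σ ++ block e k n))) : (advance e z k σ).Dom := by
  rw [hc.space, dom_iff_exists_evaln_isSome] at hy hz
  obtain ⟨s, hs⟩ := hy
  obtain ⟨t, ht⟩ := hz
  refine Nat.rfind_dom.2 ⟨Nat.pair n (max s t), ?_, fun {m} _ => ?_⟩
  · simp [test, hc.learner, evaln_isSome_mono (le_max_left s t) hs,
      evaln_isSome_mono (le_max_right s t) ht]
  · simp [test, hc.learner]

theorem Codes.hist_succ_dom (hc : Codes H M e) (hrange : Set.range H = Set.range family)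
    (hlearn : ∀ L ∈ Set.range family, ∀ T : ℕ → Option ℕ, IsText T L → ∀ D : Finset ℕ,
      ∀ᶠ n in atTop, H (M (pref T n)) ∩ ↑D = L ∩ ↑D)
    {k : ℕ} (hk : (hist e k).Dom) : (hist e (k + 1)).Dom := by
  by_contra hstuck
  obtain ⟨σ, hσ⟩ := Part.dom_iff_mem.1 hk
  have hnot : ¬ (advance e 0 k σ).Dom := fun h =>
    hstuck (by simpa [hist, Part.eq_some_iff.2 hσ] using h)
  by_cases hadv : (advance e (k + 1) k σ).Dom
  · obtain ⟨τ, hτ⟩ := Part.dom_iff_mem.1 hadv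
    have hy := (hc.of_mem_advance hτ).1
    obtain ⟨n, rfl⟩ := exists_append_block hτ
    obtain ⟨i, hi⟩ : H (M (σ ++ block e k n)) ∈ Set.range family := hrange ▸ Set.mem_range_self _
    have hik := eq_of_mem_family hstuck (hi ▸ hy)
    have hz := (zero_mem_family_succ hσ).2 hadv
    rw [← hik, hi] at hz
    exact hnot (hc.advance_dom hy hz)
  · let T : ℕ → Option ℕ := fun n => σ.getD n (some (Nat.pair e (k + 1)))
    have hσT : pref T σ.length = σ := pref_of_getElem? fun n hn => by simp [T, hn]
    have hpref : ∀ n, pref T (σ.length + (n + 1)) = σ ++ block e k n := fun n => by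
      rw [pref, List.range_add, List.map_append, ← pref, hσT, block, List.map_map]
      exact congrArg (σ ++ ·) (List.map_congr_left fun m _ => by simp [T])
    have hText : IsText T (family (Nat.pair e (k + 1))) := by
      ext x
      have hocc : (∃ n, T n = some x) ↔ ∃ j ≤ k, x = Nat.pair e (j + 1) := by
        constructor
        · rintro ⟨n, hn⟩
          have : some x ∈ σ ++ block e k n := hpref n ▸ mem_pref.2 ⟨n, by omega, hn⟩
          rcases List.mem_append.1 this with h | h
          · obtain ⟨j, hj, h⟩ := (mem_of_mem_hist hσ _).1 h
            exact ⟨j, hj.le, Option.some.inj h⟩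
          · exact ⟨k, le_rfl, Option.some.inj (mem_block.1 h)⟩
        · rintro ⟨j, hj, rfl⟩
          have : some (Nat.pair e (j + 1)) ∈ pref T (σ.length + (0 + 1)) := by
            rw [hpref, List.mem_append, mem_block, mem_of_mem_hist hσ]
            rcases hj.eq_or_lt with rfl | hj
            · exact Or.inr rfl
            · exact Or.inl ⟨j, hj, rfl⟩
          obtain ⟨m, -, hm⟩ := mem_pref.1 this
          exact ⟨m, hm⟩
      rw [Set.mem_ofPred_eq, hocc]
      constructor
      · rintro ⟨j, hj, rfl⟩
        exact mem_family_succ.2 ⟨hj, hk⟩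
      · intro hx
        obtain ⟨c, rfl⟩ : ∃ c, x = Nat.pair e c := exists_eq_pair (by simpa using hx.1)
        cases c with
        | zero => exact absurd ((zero_mem_family_succ hσ).1 hx) hadv
        | succ j => exact ⟨j, (mem_family_succ.1 hx).1, rfl⟩
    obtain ⟨N, hN⟩ := eventually_atTop.1
      (hlearn _ (Set.mem_range_self _) T hText {Nat.pair e (k + 1)})
    have hD := Set.ext_iff.1 (hN (σ.length + (N + 1)) (by omega)) (Nat.pair e (k + 1))
    rw [hpref] at hD
    have hy : Nat.pair e (k + 1) ∈ H (M (σ ++ block e k N)) :=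
      (hD.2 ⟨mem_family_succ.2 ⟨le_rfl, hk⟩, by simp⟩).1
    exact hadv (hc.advance_dom hy hy)

/-- The learner is fooled on the set `⟨e, 0⟩` once all searches succeed. -/
theorem Codes.not_learns_of_forall_dom (hc : Codes H M e) (hdom : ∀ k, (hist e k).Dom)
    (hlearn : ∀ T : ℕ → Option ℕ, IsText T (family (Nat.pair e 0)) → ∀ D : Finset ℕ,
      ∀ᶠ n in atTop, H (M (pref T n)) ∩ ↑D = family (Nat.pair e 0) ∩ ↑D) : False := by
  choose σ hσ using fun k => Part.dom_iff_mem.1 (hdom k)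
  have hstep : ∀ k, σ (k + 1) ∈ advance e 0 k (σ k) := fun k => by
    have := hσ (k + 1)
    rwa [hist, Part.eq_some_iff.2 (hσ k), Part.bind_some] at this
  have hprefix : ∀ {j k}, j ≤ k → σ j <+: σ k := fun {j k} hjk => by
    induction k, hjk using Nat.le_induction with
    | base => exact List.prefix_rfl
    | succ k _ ih =>
      obtain ⟨n, hn⟩ := exists_append_block (hstep k)
      exact ih.trans (hn ▸ List.prefix_append _ _)
  have hlen : ∀ k, k ≤ (σ k).length := fun k => by
    induction k with
    | zero => exact Nat.zero_le _
    | succ k ih =>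
      obtain ⟨n, hn⟩ := exists_append_block (hstep k)
      rw [hn]
      simp only [block, List.length_append, List.length_map, List.length_range]
      omega
  let T : ℕ → Option ℕ := fun n => (σ (n + 1)).getD n none
  have hT : ∀ k, pref T (σ k).length = σ k := fun k => pref_of_getElem? fun n hn => by
    have hnlt : n < (σ (n + 1)).length := hlen (n + 1)
    have hget : (σ (n + 1))[n] = (σ k)[n] := by
      rcases le_total (n + 1) k with h | h
      · exact (hprefix h).getElem hnlt
      · exact ((hprefix h).getElem hn).symm
    simp [T, hn, hnlt, hget]
  have hText : IsText T (family (Nat.pair e 0)) := by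
    ext x
    constructor
    · rintro ⟨n, hn⟩
      have : some x ∈ σ (n + 1) := hT (n + 1) ▸ mem_pref.2 ⟨n, hlen (n + 1), hn⟩
      obtain ⟨j, -, hj⟩ := (mem_of_mem_hist (hσ _) _).1 this
      rw [Option.some.inj hj]
      exact mem_family_zero.2 (hdom _)
    · intro hx
      obtain ⟨c, rfl⟩ : ∃ c, x = Nat.pair e c := exists_eq_pair (by simpa using hx.1)
      cases c with
      | zero => exact absurd hx zero_notMem_family_zero
      | succ j =>
        have : some (Nat.pair e (j + 1)) ∈ σ (j + 1) :=
          (mem_of_mem_hist (hσ _) _).2 ⟨j, j.lt_succ_self, rfl⟩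
        rw [← hT (j + 1)] at this
        obtain ⟨m, -, hm⟩ := mem_pref.1 this
        exact ⟨m, hm⟩
  obtain ⟨N, hN⟩ := eventually_atTop.1 (hlearn T hText {Nat.pair e 0})
  have hD := Set.ext_iff.1 (hN (σ (N + 1)).length (by have := hlen (N + 1); omega)) (Nat.pair e 0)
  rw [hT] at hD
  exact zero_notMem_family_zero (hD.1 ⟨(hc.of_mem_advance (hstep N)).2, by simp⟩).1

end Diagonalization

end ApproxSeparation

open ApproxSeparation in
/-- There is a uniformly r.e. class which is Approx learnable but not
class-preservingly FinApprox learnable. -/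
theorem stmt12 :
    ∃ H : ℕ → Set ℕ, UniformlyRE H ∧
      (∃ M : List (Option ℕ) → ℕ, Computable M ∧ ApproxLearns M (Set.range H)) ∧
      ¬ ∃ H' : ℕ → Set ℕ, UniformlyRE H' ∧ Set.range H' = Set.range H ∧
        ∃ M : List (Option ℕ) → ℕ, Computable M ∧
          ∀ L ∈ Set.range H, ∀ T : ℕ → Option ℕ, IsText T L → ∀ D : Finset ℕ,
            ∀ᶠ n in atTop, H' (M (pref T n)) ∩ ↑D = L ∩ ↑D := by
  obtain ⟨M, hM, hcontent⟩ := exists_content_learner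
  refine ⟨family, uniformlyRE_family, ⟨M, hM, approxLearns_of_content hcontent ?_⟩, ?_⟩
  · rintro _ ⟨i, rfl⟩
    exact infinite_compl_family i
  · rintro ⟨H, hH, hrange, M, hM, hlearn⟩
    obtain ⟨e, hc⟩ := exists_codes hH hM
    have hdom : ∀ k, (hist e k).Dom := fun k => by
      induction k with
      | zero => trivial
      | succ k ih => exact hc.hist_succ_dom hrange hlearn ih
    exact hc.not_learns_of_forall_dom hdom (hlearn _ (Set.mem_range_self _))
end

section
/- If there is a single learner which simultaneously conservatively partially (ConsvPart) learns a class C of r.e. sets and behaviourally correctly (BC) learns C, then there is a learner N which explanatorily (Ex) learns C, is prudent, and is conservative in the sense that on each text for every L ∈ C it outputs exactly one index e with L ⊆ W_e. -/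
open Filter

open Nat.Partrec (Code)
open Nat.Partrec.Code

namespace PrudentLearning

/-! ### Candidate hypotheses and their refutation -/

/-- The numbers occurring in a finite sequence. -/
def content (σ : List (Option ℕ)) : List ℕ := σ.filterMap id

/-- An enumeration of all finite sequences. -/
def seqOf (i : ℕ) : List (Option ℕ) := (Encodable.decode i).getD []

/-- The finite sequence attached to the candidate `k`; every sequence is attached to
infinitely many candidates. -/
def cand (k : ℕ) : List (Option ℕ) := seqOf k.unpair.1

/-- The output on `σ` of the learner with program `c`, if it is found within `t` steps. -/
def appr (c : Code) (t : ℕ) (σ : List (Option ℕ)) : Option ℕ := evaln t c (Encodable.encode σ)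

/-- The elements enumerated within `t` steps into the learner's conjecture on `cand k`. -/
def enumList (c : Code) (k t : ℕ) : List ℕ :=
  (List.range t).filter fun x =>
    ((appr c t (cand k)).bind fun e => evaln t (Denumerable.ofNat Code e) x).isSome

/-- The elements enumerated within `t` steps, as a set. -/
def enumSet (c : Code) (k t : ℕ) : Set ℕ := {x | x ∈ enumList c k t}

/-- Candidate `k` is valid for `B` if its sequence has its content in `B` and below `k`. -/
def Valid (k : ℕ) (B : Set ℕ) : Prop := ∀ x ∈ content (cand k), x < k ∧ x ∈ B

/-- Within `t` steps, the learner is seen to change its mind on an extension of `cand k` by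
elements of `B`. -/
def MindChange (c : Code) (k t : ℕ) (B : Set ℕ) : Prop :=
  ∃ i < t, (∀ x ∈ content (seqOf i), x ∈ B) ∧ (appr c t (cand k)).isSome ∧
    (appr c t (cand k ++ seqOf i)).isSome ∧ appr c t (cand k) ≠ appr c t (cand k ++ seqOf i)

/-- The stage `t` is good for the candidate `k` with initial segment `F`: the approximation at
this stage may be enumerated into the hypothesis. -/
def Good (c : Code) (F : Set ℕ) (k t : ℕ) : Prop :=
  Valid k (enumSet c k t) ∧ ¬ MindChange c k t (enumSet c k t) ∧
    (∀ x < k, (x ∈ F ↔ x ∈ enumSet c k t)) ∧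
    ∀ j, ∀ _ : j < k, Valid j (enumSet c k t) → MindChange c j t (enumSet c k t) ∧
      ∃ x ∈ enumSet c k t, ∀ s < t, Good c F j s → x ∉ enumSet c j s
termination_by k

/-- The hypothesis of candidate `k` with initial segment `F`. -/
def Hyp (c : Code) (F : Set ℕ) (k : ℕ) : Set ℕ := {x | ∃ t, Good c F k t ∧ x ∈ enumSet c k t}

/-- Candidate `k` with initial segment `F` is seen within `t` steps to be wrong for `B`. -/
def Refuted (c : Code) (F : Set ℕ) (k t : ℕ) (B : Set ℕ) : Prop :=
  MindChange c k t B ∧ ∃ x ∈ B, ∀ s < t, Good c F k s → x ∉ enumSet c k s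

/-- `k` is the least valid candidate that is never refuted on `L`. -/
def Selected (c : Code) (L : Set ℕ) (k : ℕ) : Prop :=
  Valid k L ∧ (∀ t, ¬ Refuted c L k t L) ∧ ∀ j < k, Valid j L → ∃ t, Refuted c L j t L

lemma mem_content {σ : List (Option ℕ)} {x : ℕ} : x ∈ content σ ↔ some x ∈ σ := by
  simp [content]

lemma appr_mono {c : Code} {s t : ℕ} (h : s ≤ t) {σ : List (Option ℕ)} {e : ℕ}
    (he : appr c s σ = some e) : appr c t σ = some e :=
  evaln_mono h he

lemma mem_enumSet {c : Code} {k t x : ℕ} :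
    x ∈ enumSet c k t ↔ ∃ e, appr c t (cand k) = some e ∧
      ∃ y, evaln t (Denumerable.ofNat Code e) x = some y := by
  simp only [enumSet, enumList, Set.mem_ofPred_eq, List.mem_filter, List.mem_range,
    Option.isSome_iff_exists, Option.bind_eq_some_iff]
  constructor
  · rintro ⟨-, y, e, he, hy⟩
    exact ⟨e, he, y, hy⟩
  · rintro ⟨e, he, y, hy⟩
    exact ⟨evaln_bound hy, y, e, he, hy⟩

lemma enumSet_mono (c : Code) (k : ℕ) : Monotone (enumSet c k) := by
  intro s t h x hx
  obtain ⟨e, he, y, hy⟩ := mem_enumSet.1 hx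
  exact mem_enumSet.2 ⟨e, appr_mono h he, y, evaln_mono h hy⟩

lemma Valid.congr {k : ℕ} {A B : Set ℕ} (h : ∀ x < k, (x ∈ A ↔ x ∈ B)) (hA : Valid k A) :
    Valid k B :=
  fun x hx => ⟨(hA x hx).1, (h x (hA x hx).1).1 (hA x hx).2⟩

lemma Valid.mono {k : ℕ} {A B : Set ℕ} (h : A ⊆ B) (hA : Valid k A) : Valid k B :=
  fun x hx => ⟨(hA x hx).1, h (hA x hx).2⟩

lemma MindChange.mono {c : Code} {k s t : ℕ} {A B : Set ℕ} (hst : s ≤ t) (hAB : A ⊆ B)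
    (h : MindChange c k s A) : MindChange c k t B := by
  obtain ⟨i, hi, hA, h1, h2, hne⟩ := h
  obtain ⟨u, hu⟩ := Option.isSome_iff_exists.1 h1
  obtain ⟨v, hv⟩ := Option.isSome_iff_exists.1 h2
  refine ⟨i, hi.trans_le hst, fun x hx => hAB (hA x hx), ?_⟩
  rw [hu, hv] at hne
  rw [appr_mono hst hu, appr_mono hst hv]
  simpa using hne

lemma Good.congr {c : Code} {F G : Set ℕ} {k : ℕ} (h : ∀ x < k, (x ∈ F ↔ x ∈ G)) (t : ℕ) :
    Good c F k t ↔ Good c G k t := by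
  induction k using Nat.strong_induction_on generalizing t with
  | _ k ih =>
    have key : ∀ j, j < k → ∀ s, (Good c F j s ↔ Good c G j s) := fun j hj s =>
      ih j hj (fun x hx => h x (hx.trans hj)) s
    have h3 : (∀ x < k, (x ∈ F ↔ x ∈ enumSet c k t)) ↔
        (∀ x < k, (x ∈ G ↔ x ∈ enumSet c k t)) :=
      forall₂_congr fun x hx => by rw [h x hx]
    rw [Good, Good, h3]
    refine and_congr_right fun _ => and_congr_right fun _ => and_congr_right fun _ =>
      forall₂_congr fun j hj => ?_
    simp only [key j hj]

lemma Refuted.congr {c : Code} {F G : Set ℕ} {k : ℕ} (h : ∀ x < k, (x ∈ F ↔ x ∈ G)) (t : ℕ)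
    (B : Set ℕ) : Refuted c F k t B ↔ Refuted c G k t B := by
  simp only [Refuted, Good.congr h]

lemma Hyp.congr {c : Code} {F G : Set ℕ} {k : ℕ} (h : ∀ x < k, (x ∈ F ↔ x ∈ G)) :
    Hyp c F k = Hyp c G k := by
  simp only [Hyp, Good.congr h]

lemma Refuted.mono_set {c : Code} {F : Set ℕ} {k t : ℕ} {A B : Set ℕ} (hAB : A ⊆ B)
    (h : Refuted c F k t A) : Refuted c F k t B :=
  ⟨h.1.mono le_rfl hAB, h.2.imp fun _ hx => ⟨hAB hx.1, hx.2⟩⟩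

lemma Refuted.mono_time {c : Code} {F : Set ℕ} {k s t : ℕ} {B : Set ℕ} (hst : s ≤ t)
    (h : Refuted c F k s B) : Refuted c F k t B := by
  induction t, hst using Nat.le_induction with
  | base => exact h
  | succ t _ ih =>
    refine ⟨ih.1.mono t.le_succ subset_rfl, ?_⟩
    by_cases hg : Good c F k t
    · have hB : ¬ B ⊆ enumSet c k t := by
        rw [Good] at hg
        exact fun hB => hg.2.1 (ih.1.mono le_rfl hB)
      obtain ⟨y, hy, hyt⟩ := Set.not_subset.1 hB
      exact ⟨y, hy, fun s hs _ hys => hyt (enumSet_mono c k (Nat.lt_succ_iff.1 hs) hys)⟩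
    · obtain ⟨x, hx, hxt⟩ := ih.2
      refine ⟨x, hx, fun s hs hgs => ?_⟩
      rcases (Nat.lt_succ_iff.1 hs).lt_or_eq with h | rfl
      · exact hxt s h hgs
      · exact absurd hgs hg

lemma Refuted.exists_finite {c : Code} {F : Set ℕ} {k t : ℕ} {L : Set ℕ}
    (h : Refuted c F k t L) : ∃ B ⊆ L, B.Finite ∧ Refuted c F k t B := by
  obtain ⟨⟨i, hi, hL, h1⟩, x, hx, hxt⟩ := h
  refine ⟨insert x {y | y ∈ content (seqOf i)}, ?_, ?_, ⟨i, hi, ?_, h1⟩, x, ?_, hxt⟩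
  · exact Set.insert_subset hx hL
  · exact (List.finite_toSet _).insert x
  · exact fun y hy => Set.mem_insert_of_mem _ hy
  · exact Set.mem_insert _ _

lemma not_refuted_hyp (c : Code) (F : Set ℕ) (k t : ℕ) : ¬ Refuted c F k t (Hyp c F k) := by
  intro h
  obtain ⟨B, hB, hfin, h⟩ := h.exists_finite
  have : ∀ᶠ s in atTop, ∀ x ∈ B, ∃ r < s, Good c F k r ∧ x ∈ enumSet c k r := by
    refine (eventually_all_finite hfin).2 fun x hx => ?_
    obtain ⟨r, hr, hxr⟩ := hB hx
    filter_upwards [eventually_gt_atTop r] with s hs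
    exact ⟨r, hs, hr, hxr⟩
  obtain ⟨s, hs, hts⟩ := (this.and (eventually_ge_atTop t)).exists
  obtain ⟨x, hx, hxs⟩ := (h.mono_time hts).2
  obtain ⟨r, hr, hg, hxr⟩ := hs x hx
  exact hxs r hr hg hxr

lemma mem_hyp_iff_of_lt {c : Code} {F : Set ℕ} {k : ℕ} (h : (Hyp c F k).Nonempty) {x : ℕ}
    (hx : x < k) : x ∈ F ↔ x ∈ Hyp c F k := by
  constructor
  · obtain ⟨-, t, hg, -⟩ := h
    refine fun hxF => ⟨t, hg, ?_⟩
    rw [Good] at hg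
    exact (hg.2.2.1 x hx).1 hxF
  · rintro ⟨t, hg, hxt⟩
    rw [Good] at hg
    exact (hg.2.2.1 x hx).2 hxt

/-- A nonempty hypothesis selects its own candidate. -/
lemma selected_hyp {c : Code} {F : Set ℕ} {k : ℕ} (h : (Hyp c F k).Nonempty) :
    Selected c (Hyp c F k) k := by
  have hF : ∀ x < k, (x ∈ F ↔ x ∈ Hyp c F k) := fun x hx => mem_hyp_iff_of_lt h hx
  obtain ⟨-, t, hg, -⟩ := h
  have hsub : enumSet c k t ⊆ Hyp c F k := fun x hx => ⟨t, hg, hx⟩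
  rw [Good] at hg
  obtain ⟨h1, -, h3, h4⟩ := hg
  refine ⟨h1.mono hsub, fun s hs => not_refuted_hyp c F k s ((Refuted.congr hF _ _).2 hs),
    fun j hj hv => ⟨t, ?_⟩⟩
  have hvj : Valid j (enumSet c k t) :=
    hv.congr fun x hx => by rw [← hF x (hx.trans hj), h3 x (hx.trans hj)]
  have hr : Refuted c F j t (enumSet c k t) := h4 j hj hvj
  exact ((Refuted.congr (fun x hx => hF x (hx.trans hj)) _ _).1 hr).mono_set hsub

/-- If the candidate chosen on a subset `A` of `L` has a hypothesis including `L`, then it is the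
candidate selected by `L`. -/
lemma Selected.eq_of_subset_hyp {c : Code} {L A : Set ℕ} {k j : ℕ} (hk : Selected c L k)
    (hL : L.Nonempty) (hAL : A ⊆ L) (hvj : Valid j A)
    (hj : ∀ i < j, Valid i A → ∃ t, Refuted c A i t A) (hsub : L ⊆ Hyp c A j) :
    j = k ∧ ∀ x < k, (x ∈ A ↔ x ∈ L) := by
  have hne := hL.mono hsub
  have hV := selected_hyp hne
  have hAV : ∀ x < j, (x ∈ A ↔ x ∈ Hyp c A j) := fun x hx => mem_hyp_iff_of_lt hne hx
  have hA : ∀ x < j, (x ∈ A ↔ x ∈ L) := fun x hx =>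
    ⟨fun h => hAL h, fun h => (hAV x hx).2 (hsub h)⟩
  have hjk : j = k := by
    rcases lt_trichotomy j k with h | h | h
    · obtain ⟨t, ht⟩ := hk.2.2 j h (hvj.mono hAL)
      refine absurd ?_ (hV.2.1 t)
      refine ((Refuted.congr (fun x hx => ?_) _ _).1 ht).mono_set hsub
      rw [← hA x hx, hAV x hx]
    · exact h
    · obtain ⟨t, ht⟩ := hj k h (hk.1.congr fun x hx => (hA x (hx.trans h)).symm)
      refine absurd ?_ (hk.2.1 t)
      exact ((Refuted.congr (fun x hx => hA x (hx.trans h)) _ _).1 ht).mono_set hAL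
  exact ⟨hjk, hjk ▸ hA⟩

/-! ### Texts and locking sequences -/

lemma length_pref (T : ℕ → Option ℕ) (n : ℕ) : (pref T n).length = n := by simp [pref]

lemma some_mem_pref {T : ℕ → Option ℕ} {n x : ℕ} :
    some x ∈ pref T n ↔ ∃ m < n, T m = some x := by
  simp [pref]

lemma mem_iff_of_isText {T : ℕ → Option ℕ} {L : Set ℕ} (hT : IsText T L) {x : ℕ} :
    x ∈ L ↔ ∃ n, T n = some x := by
  rw [← hT]
  rfl

/-- The set of numbers occurring among the first `n` entries of `T`. -/
def seen (T : ℕ → Option ℕ) (n : ℕ) : Set ℕ := {x | x ∈ content (pref T n)}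

lemma mem_seen {T : ℕ → Option ℕ} {n x : ℕ} : x ∈ seen T n ↔ ∃ m < n, T m = some x :=
  mem_content.trans some_mem_pref

lemma seen_subset {T : ℕ → Option ℕ} {L : Set ℕ} (hT : IsText T L) (n : ℕ) :
    seen T n ⊆ L := by
  intro x hx
  obtain ⟨m, -, hm⟩ := mem_seen.1 hx
  exact (mem_iff_of_isText hT).2 ⟨m, hm⟩

lemma eventually_subset_seen {T : ℕ → Option ℕ} {L : Set ℕ} (hT : IsText T L)
    {B : Set ℕ} (hB : B ⊆ L) (hfin : B.Finite) : ∀ᶠ n in atTop, B ⊆ seen T n := by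
  refine (eventually_all_finite hfin).2 fun x hx => ?_
  obtain ⟨m, hm⟩ := (mem_iff_of_isText hT).1 (hB hx)
  filter_upwards [eventually_gt_atTop m] with n hn
  exact mem_seen.2 ⟨m, hn, hm⟩

open Classical in
/-- A text for `L`. -/
noncomputable def baseText (L : Set ℕ) (n : ℕ) : Option ℕ := if n ∈ L then some n else none

lemma baseText_eq_some {L : Set ℕ} {n x : ℕ} : baseText L n = some x ↔ n = x ∧ x ∈ L := by
  unfold baseText
  split_ifs with h
  · simp only [Option.some.injEq]
    exact ⟨fun e => ⟨e, e ▸ h⟩, fun e => e.1⟩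
  · simp only [false_iff]
    rintro ⟨rfl, hx⟩
    exact h hx

/-- The text which starts with `σ` and continues with `T`. -/
def extendText (σ : List (Option ℕ)) (T : ℕ → Option ℕ) (n : ℕ) : Option ℕ :=
  if n < σ.length then σ.getD n none else T (n - σ.length)

lemma pref_extendText (σ : List (Option ℕ)) (T : ℕ → Option ℕ) (n : ℕ) :
    pref (extendText σ T) (σ.length + n) = σ ++ pref T n := by
  refine List.ext_getElem (by simp [pref]) fun i h1 h2 => ?_
  by_cases h : i < σ.length
  · simp [pref, extendText, h, List.getElem_append_left h]
  · simp [pref, extendText, h, List.getElem_append_right (not_lt.1 h)]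

lemma isText_extendText {σ : List (Option ℕ)} {L : Set ℕ} (hσ : ∀ x ∈ content σ, x ∈ L) :
    IsText (extendText σ (baseText L)) L := by
  ext x
  constructor
  · rintro ⟨n, hn⟩
    unfold extendText at hn
    split_ifs at hn with h
    · refine hσ x (mem_content.2 ?_)
      rw [← hn, List.getD_eq_getElem _ _ h]
      exact List.getElem_mem h
    · exact (baseText_eq_some.1 hn).2
  · intro hx
    exact ⟨σ.length + x, by simpa [extendText] using baseText_eq_some.2 ⟨rfl, hx⟩⟩

/-- `M` converges on every text for `L` to an index of `L`, and none of its conjectures on texts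
for `L` is a proper superset of `L`. -/
def LearnsSafely (M : List (Option ℕ) → ℕ) (L : Set ℕ) : Prop :=
  ∀ T, IsText T L → (∃ e n₀, Wset e = L ∧ ∀ n ≥ n₀, M (pref T n) = e) ∧
    ∀ n, L ⊆ Wset (M (pref T n)) → Wset (M (pref T n)) = L

lemma learnsSafely {M : List (Option ℕ) → ℕ} {C : Set (Set ℕ)} (hcons : ConsvLearner M C)
    (hbc : BCLearns M C) {L : Set ℕ} (hL : L ∈ C) : LearnsSafely M L := by
  intro T hT
  obtain ⟨e, -, he⟩ := hcons L hL T hT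
  obtain ⟨n₀, hn₀⟩ := eventually_atTop.1 (hbc L hL T hT)
  have hconv : ∀ n ≥ n₀, M (pref T n) = e := fun n hn =>
    he _ ⟨⟨n, rfl⟩, (hn₀ n hn).ge⟩
  have heL : Wset e = L := hconv n₀ le_rfl ▸ hn₀ n₀ le_rfl
  exact ⟨⟨e, n₀, heL, hconv⟩, fun n hn => by rw [he _ ⟨⟨n, rfl⟩, hn⟩, heL]⟩

lemma LearnsSafely.eq_of_subset {M : List (Option ℕ) → ℕ} {L : Set ℕ} (h : LearnsSafely M L)
    {σ : List (Option ℕ)} (hσ : ∀ x ∈ content σ, x ∈ L) (hsub : L ⊆ Wset (M σ)) :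
    Wset (M σ) = L := by
  have hp : pref (extendText σ (baseText L)) σ.length = σ := by
    simpa [pref] using pref_extendText σ (baseText L) 0
  have := (h _ (isText_extendText hσ)).2 σ.length
  rw [hp] at this
  exact this hsub

lemma LearnsSafely.eq_of_locking {M : List (Option ℕ) → ℕ} {L : Set ℕ} (h : LearnsSafely M L)
    {σ : List (Option ℕ)} (hσ : ∀ x ∈ content σ, x ∈ L)
    (hlock : ∀ ρ, (∀ x ∈ content ρ, x ∈ L) → M (σ ++ ρ) = M σ) : Wset (M σ) = L := by
  obtain ⟨⟨e, n₀, heL, he⟩, -⟩ := h _ (isText_extendText hσ)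
  have h1 := he (σ.length + n₀) (Nat.le_add_left _ _)
  rw [pref_extendText, hlock] at h1
  · rw [h1, heL]
  · intro x hx
    obtain ⟨m, -, hm⟩ := mem_seen.1 hx
    exact (baseText_eq_some.1 hm).2

lemma LearnsSafely.exists_locking {M : List (Option ℕ) → ℕ} {L : Set ℕ}
    (h : LearnsSafely M L) : ∃ σ, (∀ x ∈ content σ, x ∈ L) ∧
      ∀ ρ, (∀ x ∈ content ρ, x ∈ L) → M (σ ++ ρ) = M σ := by
  by_contra! hcon
  choose! ρ hρL hρM using hcon
  let S : ℕ → List (Option ℕ) := fun n => Nat.rec [] (fun n s => s ++ ρ s ++ [baseText L n]) n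
  have hS : ∀ n, S (n + 1) = S n ++ ρ (S n) ++ [baseText L n] := fun n => rfl
  have hSL : ∀ n, ∀ x ∈ content (S n), x ∈ L := by
    intro n
    induction n with
    | zero => simp [S, content]
    | succ n ih =>
      intro x hx
      rw [hS, mem_content, List.mem_append, List.mem_append, List.mem_singleton] at hx
      rcases hx with (hx | hx) | hx
      · exact ih x (mem_content.2 hx)
      · exact hρL _ ih x (mem_content.2 hx)
      · exact (baseText_eq_some.1 hx.symm).2
  have hlen : ∀ n, n ≤ (S n).length := by
    intro n
    induction n with
    | zero => simp
    | succ n ih =>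
      rw [hS]
      simp only [List.length_append, List.length_singleton]
      omega
  have hpre : ∀ n m, n ≤ m → S n <+: S m := by
    intro n m hnm
    induction m, hnm using Nat.le_induction with
    | base => exact List.prefix_rfl
    | succ m _ ih =>
      refine ih.trans ?_
      rw [hS, List.append_assoc]
      exact List.prefix_append _ _
  let T : ℕ → Option ℕ := fun n => (S (n + 1)).getD n none
  have hT : ∀ n i, i < (S n).length → T i = (S n).getD i none := by
    intro n i hi
    have hi' : i < (S (i + 1)).length := hlen (i + 1)
    have h1 := (hpre n (max n (i + 1)) (le_max_left _ _)).getElem hi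
    have h2 := (hpre (i + 1) (max n (i + 1)) (le_max_right _ _)).getElem hi'
    simp only [T]
    rw [List.getD_eq_getElem _ _ hi, List.getD_eq_getElem _ _ hi', h1, h2]
  have hpref : ∀ n m, m ≤ (S n).length → pref T m = (S n).take m := by
    intro n m hm
    refine List.ext_getElem (by simp [pref, hm]) fun i h1 h2 => ?_
    have hi : i < m := by simpa [pref] using h1
    simp [pref, hT n i (hi.trans_le hm), hi.trans_le hm]
  have htext : IsText T L := by
    ext x
    constructor
    · rintro ⟨n, hn⟩
      refine hSL (n + 1) x (mem_content.2 ?_)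
      rw [← hn]
      simp only [T]
      rw [List.getD_eq_getElem _ _ (hlen (n + 1))]
      exact List.getElem_mem _
    · intro hx
      have hmem : some x ∈ S (x + 1) := by
        rw [hS, baseText_eq_some.2 ⟨rfl, hx⟩]
        simp
      obtain ⟨i, hi, hix⟩ := List.getElem_of_mem hmem
      exact ⟨i, by rw [hT (x + 1) i hi, List.getD_eq_getElem _ _ hi, hix]⟩
  obtain ⟨⟨e, n₀, -, he⟩, -⟩ := h T htext
  have h1 := he (S n₀).length (hlen n₀)
  have hle : (S n₀ ++ ρ (S n₀)).length ≤ (S (n₀ + 1)).length := by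
    rw [hS, List.length_append (as := S n₀ ++ ρ (S n₀))]
    omega
  have h2 := he (S n₀ ++ ρ (S n₀)).length
    ((hlen n₀).trans (by rw [List.length_append]; omega))
  rw [hpref n₀ _ le_rfl, List.take_length] at h1
  rw [hpref (n₀ + 1) _ hle, hS, List.take_left] at h2
  exact hρM _ (hSL n₀) (h2.trans h1.symm)

/-! ### The hypothesis selected by a learnable set -/

section Program

variable {M : List (Option ℕ) → ℕ} {c : Code}

/-- The program `c` computes the learner `M`. -/
def Computes (c : Code) (M : List (Option ℕ) → ℕ) : Prop :=
  ∀ σ, eval c (Encodable.encode σ) = Part.some (M σ)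

lemma Computes.eq_of_appr (hc : Computes c M) {t : ℕ} {σ : List (Option ℕ)} {e : ℕ}
    (h : appr c t σ = some e) : e = M σ := by
  have := evaln_sound h
  rwa [hc σ, Part.mem_some_iff] at this

lemma Computes.eventually_appr (hc : Computes c M) (σ : List (Option ℕ)) :
    ∀ᶠ t in atTop, appr c t σ = some (M σ) := by
  have : M σ ∈ eval c (Encodable.encode σ) := by
    rw [hc σ]
    exact Part.mem_some _
  obtain ⟨s, hs⟩ := evaln_complete.1 this
  filter_upwards [eventually_ge_atTop s] with t ht
  exact appr_mono ht hs

lemma Computes.enumSet_subset (hc : Computes c M) (k t : ℕ) :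
    enumSet c k t ⊆ Wset (M (cand k)) := by
  intro x hx
  obtain ⟨e, he, y, hy⟩ := mem_enumSet.1 hx
  rw [hc.eq_of_appr he] at hy
  exact Part.dom_iff_mem.2 ⟨y, evaln_sound hy⟩

lemma Computes.hyp_subset (hc : Computes c M) (F : Set ℕ) (k : ℕ) :
    Hyp c F k ⊆ Wset (M (cand k)) := by
  rintro x ⟨t, -, hx⟩
  exact hc.enumSet_subset k t hx

lemma Computes.eventually_mem_enumSet (hc : Computes c M) {k x : ℕ}
    (hx : x ∈ Wset (M (cand k))) : ∀ᶠ t in atTop, x ∈ enumSet c k t := by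
  obtain ⟨y, hy⟩ := Part.dom_iff_mem.1 hx
  obtain ⟨s, hs⟩ := evaln_complete.1 hy
  filter_upwards [eventually_ge_atTop s, hc.eventually_appr (cand k)] with t ht he
  exact mem_enumSet.2 ⟨_, he, y, evaln_mono ht hs⟩

lemma seqOf_encode (σ : List (Option ℕ)) : seqOf (Encodable.encode σ) = σ := by
  simp [seqOf]

lemma Computes.exists_mindChange_iff (hc : Computes c M) {k : ℕ} {B : Set ℕ} :
    (∃ t, MindChange c k t B) ↔
      ∃ ρ, (∀ x ∈ content ρ, x ∈ B) ∧ M (cand k ++ ρ) ≠ M (cand k) := by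
  constructor
  · rintro ⟨t, i, -, hB, h1, h2, hne⟩
    refine ⟨seqOf i, hB, fun h => hne ?_⟩
    obtain ⟨u, hu⟩ := Option.isSome_iff_exists.1 h1
    obtain ⟨v, hv⟩ := Option.isSome_iff_exists.1 h2
    rw [hu, hv, hc.eq_of_appr hu, hc.eq_of_appr hv, h]
  · rintro ⟨ρ, hB, hne⟩
    obtain ⟨t, ht, h1, h2⟩ := ((eventually_gt_atTop (Encodable.encode ρ)).and
      ((hc.eventually_appr (cand k)).and (hc.eventually_appr (cand k ++ ρ)))).exists
    refine ⟨t, Encodable.encode ρ, ht, ?_⟩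
    rw [seqOf_encode, h1, h2]
    exact ⟨hB, rfl, rfl, fun h => hne (Option.some.inj h).symm⟩

lemma LearnsSafely.exists_selected {L : Set ℕ} (hL : LearnsSafely M L) (hc : Computes c M) :
    ∃ k, Selected c L k := by
  classical
  have hex : ∃ k, Valid k L ∧ ∀ t, ¬ Refuted c L k t L := by
    obtain ⟨σ, hσ, hlock⟩ := hL.exists_locking
    obtain ⟨b, hb⟩ := (List.finite_toSet (content σ)).bddAbove
    have hk : cand (Nat.pair (Encodable.encode σ) (b + 1)) = σ := by
      simp [cand, seqOf_encode]
    refine ⟨Nat.pair (Encodable.encode σ) (b + 1), fun x hx => ?_, fun t ht => ?_⟩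
    · rw [hk] at hx
      exact ⟨(Nat.lt_succ_of_le (hb hx)).trans_le (Nat.right_le_pair _ _), hσ x hx⟩
    · obtain ⟨ρ, hρ, hne⟩ := hc.exists_mindChange_iff.1 ⟨t, ht.1⟩
      rw [hk] at hne
      exact hne (hlock ρ hρ)
  refine ⟨Nat.find hex, (Nat.find_spec hex).1, (Nat.find_spec hex).2, fun j hj hv => ?_⟩
  have := Nat.find_min hex hj
  push Not at this
  exact this hv

lemma LearnsSafely.hyp_eq {L : Set ℕ} (hL : LearnsSafely M L) (hc : Computes c M) {k : ℕ}
    (hk : Selected c L k) : Hyp c L k = L := by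
  obtain ⟨hv, hnr, hlow⟩ := hk
  have hcand : ∀ x ∈ content (cand k), x ∈ L := fun x hx => (hv x hx).2
  by_cases hmc : ∃ t, MindChange c k t L
  · have hsub : L ⊆ Hyp c L k := by
      intro x hx
      obtain ⟨t, ht⟩ := hmc
      by_contra hxH
      exact hnr t ⟨ht, x, hx, fun s _ hg hxs => hxH ⟨s, hg, hxs⟩⟩
    refine Set.Subset.antisymm ?_ hsub
    have hW := hL.eq_of_subset hcand (hsub.trans (hc.hyp_subset L k))
    exact (hc.hyp_subset L k).trans hW.subset
  have hW : Wset (M (cand k)) = L := by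
    refine hL.eq_of_locking hcand fun ρ hρ => ?_
    by_contra hne
    exact hmc (hc.exists_mindChange_iff.2 ⟨ρ, hρ, hne⟩)
  have hEL : ∀ t, enumSet c k t ⊆ L := fun t => (hc.enumSet_subset k t).trans hW.subset
  have hev : ∀ B : Set ℕ, B ⊆ L → B.Finite → ∀ᶠ t in atTop, B ⊆ enumSet c k t :=
    fun B hB hfin => (eventually_all_finite hfin).2 fun x hx =>
      hc.eventually_mem_enumSet (hW.symm ▸ hB hx)
  have hbelow : ∀ᶠ t in atTop, ∀ x < k, (x ∈ L ↔ x ∈ enumSet c k t) := by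
    filter_upwards [hev (L ∩ Set.Iio k) Set.inter_subset_left
      ((Set.finite_Iio k).inter_of_right L)] with t ht x hx
    exact ⟨fun h => ht ⟨h, hx⟩, fun h => hEL t h⟩
  have hrefuted : ∀ᶠ t in atTop, ∀ j ∈ Set.Iio k, Valid j L →
      Refuted c L j t (enumSet c k t) := by
    refine (eventually_all_finite (Set.finite_Iio k)).2 fun j hj => ?_
    by_cases hvj : Valid j L
    · obtain ⟨s, hs⟩ := hlow j hj hvj
      obtain ⟨B, hB, hfin, hs⟩ := hs.exists_finite
      filter_upwards [hev B hB hfin, eventually_ge_atTop s] with t ht hst _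
      exact (hs.mono_time hst).mono_set ht
    · exact Eventually.of_forall fun t h => absurd h hvj
  have hgood : ∀ᶠ t in atTop, Good c L k t := by
    filter_upwards [hbelow, hrefuted] with t hb hr
    rw [Good]
    exact ⟨hv.congr hb, fun h => hmc ⟨t, h.mono le_rfl (hEL t)⟩, hb,
      fun j hj hvj => hr j hj (hvj.mono (hEL t))⟩
  refine Set.Subset.antisymm ((hc.hyp_subset L k).trans hW.subset) fun x hx => ?_
  obtain ⟨t, hg, hxt⟩ := (hgood.and (hc.eventually_mem_enumSet (hW.symm ▸ hx))).exists
  exact ⟨t, hg, hxt⟩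

end Program

/-! ### Primitive recursiveness of the construction -/

section Primrec

variable {α β : Type*} [Primcodable α] [Primcodable β]

lemma primrecPred_forall_mem {f : α → List β} {R : α → β → Prop} (hf : Primrec f)
    (hR : PrimrecRel R) : PrimrecPred fun a => ∀ b ∈ f a, R a b :=
  PrimrecRel.comp (PrimrecRel.forall_mem_list
    (R := fun b a => R a b) (hR.comp Primrec.snd Primrec.fst)) hf Primrec.id

lemma primrecPred_exists_mem {f : α → List β} {R : α → β → Prop} (hf : Primrec f)
    (hR : PrimrecRel R) : PrimrecPred fun a => ∃ b ∈ f a, R a b :=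
  PrimrecRel.comp (PrimrecRel.exists_mem_list
    (R := fun b a => R a b) (hR.comp Primrec.snd Primrec.fst)) hf Primrec.id

lemma primrecPred_forall_lt {f : α → ℕ} {R : α → ℕ → Prop} (hf : Primrec f)
    (hR : PrimrecRel R) : PrimrecPred fun a => ∀ n < f a, R a n :=
  (primrecPred_forall_mem (Primrec.list_range.comp hf) hR).of_eq fun a => by simp

lemma primrecPred_exists_lt {f : α → ℕ} {R : α → ℕ → Prop} (hf : Primrec f)
    (hR : PrimrecRel R) : PrimrecPred fun a => ∃ n < f a, R a n :=
  (primrecPred_exists_mem (Primrec.list_range.comp hf) hR).of_eq fun a => by simp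

lemma primrecPred_imp {p q : α → Prop} (hp : PrimrecPred p) (hq : PrimrecPred q) :
    PrimrecPred fun a => p a → q a :=
  (hp.not.or hq).of_eq fun _ => imp_iff_not_or.symm

lemma primrecPred_iff {p q : α → Prop} (hp : PrimrecPred p) (hq : PrimrecPred q) :
    PrimrecPred fun a => (p a ↔ q a) :=
  ((primrecPred_imp hp hq).and (primrecPred_imp hq hp)).of_eq fun _ => iff_def.symm

lemma primrecPred_isSome {f : α → Option β} (hf : Primrec f) :
    PrimrecPred fun a => (f a).isSome := by
  refine PrimrecPred.of_eq (Primrec.eq.comp (Primrec.option_isSome.comp hf)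
    (Primrec.const true)) fun a => Iff.rfl

lemma primrecPred_mem {f : α → ℕ} {g : α → List ℕ} (hf : Primrec f) (hg : Primrec g) :
    PrimrecPred fun a => f a ∈ g a :=
  (primrecPred_exists_mem (R := fun a y => y = f a) hg
    (Primrec.eq.comp Primrec.snd (hf.comp Primrec.fst))).of_eq fun a => by simp

open Primrec

lemma primrec_content : Primrec content :=
  listFilterMap .id snd

lemma primrec_seqOf : Primrec seqOf :=
  option_getD.comp Primrec.decode (const [])

lemma primrec_cand : Primrec cand :=
  primrec_seqOf.comp (fst.comp unpair)

lemma primrec_appr (c : Code) : Primrec₂ (appr c) :=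
  primrec_evaln.comp ((fst.pair (const c)).pair (Primrec.encode.comp snd))

lemma primrec_enumList (c : Code) : Primrec₂ (enumList c) := by
  have h : PrimrecRel fun (x : ℕ) (p : ℕ × ℕ) =>
      ((appr c p.2 (cand p.1)).bind fun e => evaln p.2 (Denumerable.ofNat Code e) x).isSome := by
    refine primrecPred_isSome (option_bind
      ((primrec_appr c).comp (snd.comp snd) (primrec_cand.comp (fst.comp snd))) ?_)
    exact primrec_evaln.comp (((snd.comp (snd.comp fst)).pair
      ((Primrec.ofNat Code).comp snd)).pair (fst.comp fst))
  exact (h.listFilter.comp (list_range.comp snd) Primrec.id).of_eq fun p => by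
    simp [enumList]

lemma primrecPred_valid {f : α → ℕ} {B : α → List ℕ} (hf : Primrec f) (hB : Primrec B) :
    PrimrecPred fun a => Valid (f a) {x | x ∈ B a} :=
  primrecPred_forall_mem (R := fun a x => x < f a ∧ x ∈ B a)
    (primrec_content.comp (primrec_cand.comp hf))
    (PrimrecPred.and (nat_lt.comp snd (hf.comp fst)) (primrecPred_mem snd (hB.comp fst)))

lemma primrecPred_mindChange (c : Code) {f g : α → ℕ} {B : α → List ℕ} (hf : Primrec f)
    (hg : Primrec g) (hB : Primrec B) :
    PrimrecPred fun a => MindChange c (f a) (g a) {x | x ∈ B a} := by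
  have h1 : Primrec fun p : α × ℕ => appr c (g p.1) (cand (f p.1)) :=
    (primrec_appr c).comp (hg.comp fst) (primrec_cand.comp (hf.comp fst))
  have h2 : Primrec fun p : α × ℕ => appr c (g p.1) (cand (f p.1) ++ seqOf p.2) :=
    (primrec_appr c).comp (hg.comp fst)
      (list_append.comp (primrec_cand.comp (hf.comp fst)) (primrec_seqOf.comp snd))
  have h3 : PrimrecPred fun p : α × ℕ => ∀ x ∈ content (seqOf p.2), x ∈ B p.1 :=
    primrecPred_forall_mem (R := fun (p : α × ℕ) x => x ∈ B p.1)
      (primrec_content.comp (primrec_seqOf.comp snd))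
      (primrecPred_mem snd (hB.comp (fst.comp fst)))
  exact primrecPred_exists_lt hg (h3.and ((primrecPred_isSome h1).and
    ((primrecPred_isSome h2).and (Primrec.eq.comp h1 h2).not)))

/-- The defining condition of `Good`, read off a table of its earlier values. -/
def GoodStep (c : Code) (F : List ℕ) (k t : ℕ) (l : List Bool) : Prop :=
  Valid k {x | x ∈ enumList c k t} ∧ ¬ MindChange c k t {x | x ∈ enumList c k t} ∧
    (∀ x < k, (x ∈ F ↔ x ∈ enumList c k t)) ∧
    ∀ j < k, Valid j {x | x ∈ enumList c k t} → MindChange c j t {x | x ∈ enumList c k t} ∧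
      ∃ x ∈ enumList c k t, ∀ s < t, l[Nat.pair j s]? = some true → ¬ x ∈ enumList c j s

lemma primrecPred_goodStep (c : Code) {F : α → List ℕ} {f g : α → ℕ} {l : α → List Bool}
    (hF : Primrec F) (hf : Primrec f) (hg : Primrec g) (hl : Primrec l) :
    PrimrecPred fun a => GoodStep c (F a) (f a) (g a) (l a) := by
  have hE : Primrec fun a => enumList c (f a) (g a) := (primrec_enumList c).comp hf hg
  have h3 : PrimrecPred fun a => ∀ x < f a, (x ∈ F a ↔ x ∈ enumList c (f a) (g a)) :=
    primrecPred_forall_lt hf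
      (primrecPred_iff (primrecPred_mem snd (hF.comp fst)) (primrecPred_mem snd (hE.comp fst)))
  have h5 : PrimrecPred fun p : α × ℕ => ∃ x ∈ enumList c (f p.1) (g p.1), ∀ s < g p.1,
      (l p.1)[Nat.pair p.2 s]? = some true → ¬ x ∈ enumList c p.2 s := by
    refine primrecPred_exists_mem (R := fun (p : α × ℕ) x => ∀ s < g p.1,
      (l p.1)[Nat.pair p.2 s]? = some true → ¬ x ∈ enumList c p.2 s) (hE.comp fst) ?_
    refine primrecPred_forall_lt (R := fun (q : (α × ℕ) × ℕ) s =>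
      (l q.1.1)[Nat.pair q.1.2 s]? = some true → ¬ q.2 ∈ enumList c q.1.2 s)
      (hg.comp (fst.comp fst)) ?_
    have hj : Primrec fun q : ((α × ℕ) × ℕ) × ℕ => q.1.1.2 := snd.comp (fst.comp fst)
    refine primrecPred_imp (Primrec.eq.comp (list_getElem?.comp
      (hl.comp (fst.comp (fst.comp fst))) (Primrec₂.natPair.comp hj snd)) (const (some true))) ?_
    exact (primrecPred_mem (snd.comp fst) ((primrec_enumList c).comp hj snd)).not
  have h4 : PrimrecPred fun a => ∀ j < f a, Valid j {x | x ∈ enumList c (f a) (g a)} →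
      MindChange c j (g a) {x | x ∈ enumList c (f a) (g a)} ∧
      ∃ x ∈ enumList c (f a) (g a), ∀ s < g a,
        (l a)[Nat.pair j s]? = some true → ¬ x ∈ enumList c j s :=
    primrecPred_forall_lt hf (primrecPred_imp (primrecPred_valid snd (hE.comp fst))
      ((primrecPred_mindChange c snd (hg.comp fst) (hE.comp fst)).and h5))
  exact (primrecPred_valid hf hE).and
    ((primrecPred_mindChange c hf hg hE).not.and (h3.and h4))

open Classical in
lemma primrec_good_unpair (c : Code) : Primrec₂ fun (F : List ℕ) (n : ℕ) =>
    decide (Good c {x | x ∈ F} n.unpair.1 n.unpair.2) := by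
  refine Primrec.nat_strong_rec _ (g := fun F l =>
    some (decide (GoodStep c F l.length.unpair.1 l.length.unpair.2 l))) ?_ fun F n => ?_
  · have hn : Primrec fun p : List ℕ × List Bool => p.2.length.unpair :=
      unpair.comp (list_length.comp snd)
    exact option_some.comp
      (primrecPred_goodStep c fst (fst.comp hn) (snd.comp hn) snd).decide
  · congr 1
    rw [decide_eq_decide]
    simp only [List.length_map, List.length_range]
    conv_rhs => rw [Good]
    unfold GoodStep
    refine and_congr_right fun _ => and_congr_right fun _ => and_congr_right fun _ =>
      forall₂_congr fun j hj => imp_congr_right fun _ => and_congr_right fun _ =>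
      exists_congr fun x => and_congr_right fun _ => forall₂_congr fun s hs => ?_
    have hlt : Nat.pair j s < n := by
      conv_rhs => rw [← Nat.pair_unpair n]
      exact (Nat.pair_lt_pair_left _ hj).trans (Nat.pair_lt_pair_right _ hs)
    simp [hlt, enumSet]

lemma primrecPred_good (c : Code) {F : α → List ℕ} {f g : α → ℕ} (hF : Primrec F)
    (hf : Primrec f) (hg : Primrec g) :
    PrimrecPred fun a => Good c {x | x ∈ F a} (f a) (g a) := by
  classical
  exact (Primrec.primrecPred ((primrec_good_unpair c).comp hF
    (Primrec₂.natPair.comp hf hg))).of_eq fun a => by simp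

lemma primrecPred_refuted (c : Code) {F B : α → List ℕ} {f g : α → ℕ} (hF : Primrec F)
    (hB : Primrec B) (hf : Primrec f) (hg : Primrec g) :
    PrimrecPred fun a => Refuted c {x | x ∈ F a} (f a) (g a) {x | x ∈ B a} := by
  refine (primrecPred_mindChange c hf hg hB).and ?_
  refine primrecPred_exists_mem (R := fun a x => ∀ s < g a, Good c {x | x ∈ F a} (f a) s →
    ¬ x ∈ enumList c (f a) s) hB ?_
  refine primrecPred_forall_lt (R := fun (p : α × ℕ) s => Good c {x | x ∈ F p.1} (f p.1) s →
    ¬ p.2 ∈ enumList c (f p.1) s) (hg.comp fst) ?_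
  have hk : Primrec fun p : (α × ℕ) × ℕ => f p.1.1 := hf.comp (fst.comp fst)
  exact primrecPred_imp (primrecPred_good c (hF.comp (fst.comp fst)) hk snd)
    (primrecPred_mem (snd.comp fst) ((primrec_enumList c).comp hk snd)).not

/-- The parameter theorem for projections of primitive recursive predicates. -/
lemma exists_primrec_index {P : α → ℕ → ℕ → Prop}
    (hP : PrimrecPred fun p : (α × ℕ) × ℕ => P p.1.1 p.1.2 p.2) :
    ∃ g : α → ℕ, Primrec g ∧ ∀ a, Wset (g a) = {x | ∃ t, P a x t} := by
  classical
  have h1 : Partrec fun p : α × ℕ => Nat.rfind fun t => Part.some (decide (P p.1 p.2 t)) :=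
    Partrec.rfind hP.decide.to_comp
  obtain ⟨d, hd⟩ := exists_code.1 h1
  refine ⟨fun a => Encodable.encode (curry d (Encodable.encode a)),
    Primrec.encode.comp (primrec₂_curry.comp (const d) Primrec.encode), fun a => ?_⟩
  ext x
  have h2 : phi (Encodable.encode (curry d (Encodable.encode a))) x =
      eval d (Nat.pair (Encodable.encode a) x) := by
    simp [phi, eval_curry]
  change (phi _ x).Dom ↔ _
  rw [h2, hd]
  have h3 : (Nat.rfind fun t => Part.some (decide (P a x t))).Dom ↔ ∃ t, P a x t :=
    Nat.rfind_dom.trans (by simp)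
  simpa using h3

lemma exists_hyp_index (c : Code) : ∃ g : ℕ × List ℕ → ℕ, Primrec g ∧
    ∀ k F, Wset (g (k, F)) = Hyp c {x | x ∈ F} k := by
  obtain ⟨g, hg, hW⟩ := exists_primrec_index
    (P := fun (a : ℕ × List ℕ) x t => Good c {x | x ∈ a.2} a.1 t ∧ x ∈ enumList c a.1 t)
    ((primrecPred_good c (snd.comp (fst.comp fst)) (fst.comp (fst.comp fst)) snd).and
      (primrecPred_mem (snd.comp fst)
        ((primrec_enumList c).comp (fst.comp (fst.comp fst)) snd)))
  exact ⟨g, hg, fun k F => hW (k, F)⟩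

lemma exists_empty_index : ∃ e, Wset e = ∅ := by
  obtain ⟨g, -, hW⟩ := exists_primrec_index (α := ℕ) (P := fun _ _ _ => False)
    ((Primrec.eq.comp (const 0) (const 1)).of_eq fun _ => by simp)
  exact ⟨g 0, by simp [hW]⟩

end Primrec

/-! ### The prudent learner -/

open Classical in
/-- The least valid candidate below `t` not refuted on `A` within `t` steps, and `t` if there is
none. -/
noncomputable def choice (c : Code) (A : List ℕ) (t : ℕ) : ℕ :=
  (List.range t).findIdx fun k =>
    decide (Valid k {x | x ∈ A} ∧ ¬ Refuted c {x | x ∈ A} k t {x | x ∈ A})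

open Classical in
/-- The elements of `A` below `k`, in increasing order. -/
noncomputable def below (A : Set ℕ) (k : ℕ) : List ℕ := (List.range k).filter fun x => x ∈ A

/-- The learner which conjectures the hypothesis of the currently chosen candidate, where `g`
computes indices of hypotheses and `e₀` is an index of the empty set. -/
noncomputable def learner (c : Code) (g : ℕ × List ℕ → ℕ) (e₀ : ℕ) (σ : List (Option ℕ)) : ℕ :=
  if content σ ≠ [] ∧ choice c (content σ) σ.length < σ.length then
    g (choice c (content σ) σ.length,
      below {x | x ∈ content σ} (choice c (content σ) σ.length))
  else e₀

lemma mem_below_iff {A : Set ℕ} {k x : ℕ} (hx : x < k) : x ∈ {y | y ∈ below A k} ↔ x ∈ A := by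
  simp [below, hx]

lemma below_congr {A B : Set ℕ} {k : ℕ} (h : ∀ x < k, (x ∈ A ↔ x ∈ B)) :
    below A k = below B k :=
  List.filter_congr fun x hx => by simp [h x (List.mem_range.1 hx)]

lemma choice_spec {c : Code} {A : List ℕ} {t : ℕ} (h : choice c A t < t) :
    Valid (choice c A t) {x | x ∈ A} ∧
      ∀ j < choice c A t, Valid j {x | x ∈ A} → Refuted c {x | x ∈ A} j t {x | x ∈ A} := by
  constructor
  · have h' : choice c A t < (List.range t).length := by simpa using h
    have := List.findIdx_getElem (w := h')
    simp only [decide_eq_true_eq] at this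
    exact (List.getElem_range h' : (List.range t)[choice c A t] = _) ▸ this.1
  · intro j hj hv
    have := List.not_of_lt_findIdx hj
    simp only [List.getElem_range, decide_eq_false_iff_not, not_and, not_not] at this
    exact this hv

lemma choice_eq {c : Code} {A : List ℕ} {t k : ℕ} (hkt : k < t) (hv : Valid k {x | x ∈ A})
    (hnr : ¬ Refuted c {x | x ∈ A} k t {x | x ∈ A})
    (hlow : ∀ j < k, Valid j {x | x ∈ A} → Refuted c {x | x ∈ A} j t {x | x ∈ A}) :
    choice c A t = k := by
  have hk : k < (List.range t).length := by simpa using hkt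
  refine (List.findIdx_eq hk).2 ⟨by simpa using ⟨hv, hnr⟩, fun j hj => ?_⟩
  simpa using hlow j hj

lemma primrec_learner (c : Code) {g : ℕ × List ℕ → ℕ} (hg : Primrec g) (e₀ : ℕ) :
    Primrec (learner c g e₀) := by
  classical
  have hA := primrec_content
  have hchoice : Primrec fun σ : List (Option ℕ) => choice c (content σ) σ.length := by
    refine Primrec.list_findIdx (Primrec.list_range.comp Primrec.list_length)
      (p := fun (σ : List (Option ℕ)) k => decide (Valid k {x | x ∈ content σ} ∧
        ¬ Refuted c {x | x ∈ content σ} k σ.length {x | x ∈ content σ})) ?_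
    exact ((primrecPred_valid Primrec.snd (hA.comp Primrec.fst)).and
      (primrecPred_refuted c (hA.comp Primrec.fst) (hA.comp Primrec.fst) Primrec.snd
        (Primrec.list_length.comp Primrec.fst)).not).decide
  have hbelow : Primrec fun σ : List (Option ℕ) =>
      below {x | x ∈ content σ} (choice c (content σ) σ.length) := by
    have h : PrimrecRel fun (x : ℕ) (l : List ℕ) => x ∈ l :=
      primrecPred_mem Primrec.fst Primrec.snd
    exact (h.listFilter.comp (Primrec.list_range.comp hchoice) hA).of_eq fun σ =>
      List.filter_congr fun x _ => by rw [decide_eq_decide]; rfl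
  have h := Primrec.ite
    (((Primrec.eq.comp hA (Primrec.const [])).not).and
      (Primrec.nat_lt.comp hchoice Primrec.list_length))
    (hg.comp (hchoice.pair hbelow)) (Primrec.const e₀)
  exact h.of_eq fun σ => by simp only [learner, ne_eq]

section Learner

variable {c : Code} {g : ℕ × List ℕ → ℕ} {e₀ : ℕ}

lemma learner_eq_or (σ : List (Option ℕ)) (hg : ∀ k F, Wset (g (k, F)) = Hyp c {x | x ∈ F} k) :
    learner c g e₀ σ = e₀ ∨ ∃ k, learner c g e₀ σ = g (k, below {x | x ∈ content σ} k) ∧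
      Wset (learner c g e₀ σ) = Hyp c {x | x ∈ content σ} k ∧
      Valid k {x | x ∈ content σ} ∧ ∀ j < k, Valid j {x | x ∈ content σ} →
        ∃ t, Refuted c {x | x ∈ content σ} j t {x | x ∈ content σ} := by
  by_cases h : content σ ≠ [] ∧ choice c (content σ) σ.length < σ.length
  · right
    have hN : learner c g e₀ σ = g (choice c (content σ) σ.length,
        below {x | x ∈ content σ} (choice c (content σ) σ.length)) := if_pos h
    refine ⟨_, hN, ?_, (choice_spec h.2).1, fun j hj hv => ⟨_, (choice_spec h.2).2 j hj hv⟩⟩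
    rw [hN, hg]
    exact Hyp.congr fun x hx => mem_below_iff hx
  · exact Or.inl (if_neg h)

lemma eventually_learner_eq {L : Set ℕ} {k : ℕ} (hk : Selected c L k) (hL : L.Nonempty)
    {T : ℕ → Option ℕ} (hT : IsText T L) :
    ∀ᶠ n in atTop, learner c g e₀ (pref T n) = g (k, below L k) := by
  obtain ⟨y, hy⟩ := hL
  have hbelow : ∀ᶠ n in atTop, ∀ x < k, (x ∈ seen T n ↔ x ∈ L) := by
    filter_upwards [eventually_subset_seen hT (B := L ∩ Set.Iio k) Set.inter_subset_left
      ((Set.finite_Iio k).inter_of_right L)] with n hn x hx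
    exact ⟨fun h => seen_subset hT n h, fun h => hn ⟨h, hx⟩⟩
  have hrefuted : ∀ᶠ n in atTop, ∀ j ∈ Set.Iio k, Valid j L →
      Refuted c L j n (seen T n) := by
    refine (eventually_all_finite (Set.finite_Iio k)).2 fun j hj => ?_
    by_cases hvj : Valid j L
    · obtain ⟨s, hs⟩ := hk.2.2 j hj hvj
      obtain ⟨B, hB, hfin, hs⟩ := hs.exists_finite
      filter_upwards [eventually_subset_seen hT hB hfin, eventually_ge_atTop s] with t ht hst _
      exact (hs.mono_time hst).mono_set ht
    · exact Eventually.of_forall fun t h => absurd h hvj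
  filter_upwards [hbelow, hrefuted, eventually_gt_atTop k,
    eventually_subset_seen hT (Set.singleton_subset_iff.2 hy) (Set.finite_singleton y)]
    with n hb hr hkn hyn
  have hch : choice c (content (pref T n)) n = k := by
    refine choice_eq hkn (hk.1.congr fun x hx => (hb x hx).symm) (fun h => ?_)
      fun j hj hv => ?_
    · exact hk.2.1 n (((Refuted.congr hb n _).1 h).mono_set (seen_subset hT n))
    · exact (Refuted.congr (fun x hx => hb x (hx.trans hj)) n _).2
        (hr j hj (hv.mono (seen_subset hT n)))
  have hne : content (pref T n) ≠ [] :=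
    List.ne_nil_of_mem (show y ∈ content (pref T n) from hyn rfl)
  unfold learner
  rw [length_pref, hch, if_pos ⟨hne, hkn⟩]
  exact congrArg (fun F => g (k, F)) (below_congr hb)

/-- The learner identifies every set which is the hypothesis of its selected candidate, and
conjectures only one superset of it. -/
lemma learner_learns (hg : ∀ k F, Wset (g (k, F)) = Hyp c {x | x ∈ F} k) (he₀ : Wset e₀ = ∅)
    {L : Set ℕ} (hL : L = ∅ ∨ ∃ k, Selected c L k ∧ Hyp c L k = L)
    {T : ℕ → Option ℕ} (hT : IsText T L) :
    (∃ e n₀, Wset e = L ∧ ∀ n ≥ n₀, learner c g e₀ (pref T n) = e) ∧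
      ∃! e, (∃ n, learner c g e₀ (pref T n) = e) ∧ L ⊆ Wset e := by
  rcases L.eq_empty_or_nonempty with rfl | hne
  · have hconst : ∀ n, learner c g e₀ (pref T n) = e₀ := by
      intro n
      refine if_neg fun h => h.1 (List.eq_nil_iff_forall_not_mem.2 fun x hx => ?_)
      exact seen_subset hT n hx
    refine ⟨⟨e₀, 0, he₀, fun n _ => hconst n⟩, e₀, ⟨⟨0, hconst 0⟩, Set.empty_subset _⟩, ?_⟩
    rintro e ⟨⟨n, hn⟩, -⟩
    rw [← hn, hconst]
  · obtain ⟨k, hk, hH⟩ := hL.resolve_left hne.ne_empty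
    obtain ⟨n₀, hn₀⟩ := eventually_atTop.1 (eventually_learner_eq (g := g) (e₀ := e₀) hk hne hT)
    have hW : Wset (g (k, below L k)) = L := by
      rw [hg, Hyp.congr fun x hx => mem_below_iff hx, hH]
    refine ⟨⟨_, n₀, hW, hn₀⟩, _, ⟨⟨n₀, hn₀ n₀ le_rfl⟩, hW.ge⟩, ?_⟩
    rintro e ⟨⟨n, rfl⟩, hsub⟩
    rcases learner_eq_or (e₀ := e₀) (pref T n) hg with h | ⟨j, hj, hWj, hvj, hlow⟩
    · rw [h, he₀] at hsub
      exact absurd (Set.subset_empty_iff.1 hsub) hne.ne_empty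
    · rw [hWj] at hsub
      obtain ⟨rfl, hA⟩ := hk.eq_of_subset_hyp hne (seen_subset hT n) hvj hlow hsub
      rw [hj]
      exact congrArg (fun F => g (j, F)) (below_congr hA)

end Learner

end PrudentLearning

/-- If `C` is ConsvPartBC learnable then `C` is Ex learnable by a prudent and
conservative learner. -/
theorem stmt14 (C : Set (Set ℕ)) (hC : ∀ L ∈ C, ∃ e, Wset e = L)
    (h : ∃ M : List (Option ℕ) → ℕ, Computable M ∧ PartLearns M C ∧
      ConsvLearner M C ∧ BCLearns M C) :
    ∃ N : List (Option ℕ) → ℕ, Computable N ∧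
      ExLearns N (C ∪ Conjectured N) ∧ ConsvLearner N (C ∪ Conjectured N) := by
  obtain ⟨M, hM, -, hcons, hbc⟩ := h
  obtain ⟨c, hc⟩ := exists_code.1 hM
  have hcM : PrudentLearning.Computes c M := fun σ => by simp [hc]
  obtain ⟨g, hgp, hg⟩ := PrudentLearning.exists_hyp_index c
  obtain ⟨e₀, he₀⟩ := PrudentLearning.exists_empty_index
  have hclass : ∀ L ∈ C ∪ Conjectured (PrudentLearning.learner c g e₀),
      L = ∅ ∨ ∃ k, PrudentLearning.Selected c L k ∧ PrudentLearning.Hyp c L k = L := by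
    rintro L (hL | ⟨σ, rfl⟩)
    · have hs := PrudentLearning.learnsSafely hcons hbc hL
      obtain ⟨k, hk⟩ := hs.exists_selected hcM
      exact Or.inr ⟨k, hk, hs.hyp_eq hcM hk⟩
    · rcases PrudentLearning.learner_eq_or (e₀ := e₀) σ hg with h | ⟨k, -, hW, -, -⟩
      · exact Or.inl (by rw [h, he₀])
      · rw [hW]
        refine (Set.eq_empty_or_nonempty _).imp id fun hne =>
          ⟨k, PrudentLearning.selected_hyp hne, ?_⟩
        exact (PrudentLearning.Hyp.congr
          fun x hx => PrudentLearning.mem_hyp_iff_of_lt hne hx).symm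
  exact ⟨PrudentLearning.learner c g e₀, (PrudentLearning.primrec_learner c hgp e₀).to_comp,
    fun L hL T hT => (PrudentLearning.learner_learns hg he₀ (hclass L hL) hT).1,
    fun L hL T hT => (PrudentLearning.learner_learns hg he₀ (hclass L hL) hT).2⟩
end
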